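/- arXiv:2011.09135 — 2 statements merged into one kernel-verified Lean document; each statement's English description precedes it below -/
import Mathlib

section
/- For every slot k ∈ S∖{2n−2}, every (i,j) ∈ A, and every team t ∈ V∖{i,j}, every point (x,y) ∈ Ptt(n) satisfies the two lifted inequalities x_{k,j,t} + x_{k,i,t} + x_{k+1,j,t} − 1 ≤ y_{t,i,j} and x_{k+1,i,t} + x_{k,i,t} + x_{k+1,j,t} − 1 ≤ y_{t,i,j}. -/
open Finset

attribute [local instance] Classical.propDecidable

namespace TTP

/-- `(k,i,j)` is a valid match index: slot `k ∈ S = {1,…,2n-2}`, home venue `i` and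
away team `j` are distinct elements of `V = {1,…,n}`. -/
def IsMatch (n : ℕ) (m : ℕ × ℕ × ℕ) : Prop :=
  1 ≤ m.1 ∧ m.1 ≤ 2 * n - 2 ∧ 1 ≤ m.2.1 ∧ m.2.1 ≤ n ∧ 1 ≤ m.2.2 ∧ m.2.2 ≤ n ∧ m.2.1 ≠ m.2.2

/-- `(t,i,j)` is a valid travel index: `t ∈ V` and `(i,j) ∈ A`. -/
def IsTravelIdx (n : ℕ) (p : ℕ × ℕ × ℕ) : Prop :=
  1 ≤ p.1 ∧ p.1 ≤ n ∧ 1 ≤ p.2.1 ∧ p.2.1 ≤ n ∧ 1 ≤ p.2.2 ∧ p.2.2 ≤ n ∧ p.2.1 ≠ p.2.2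

/-- A (double round-robin) tournament: a set of matches such that in every slot every team
plays exactly once, and every ordered pair of distinct teams meets exactly once. -/
structure IsTournament (n : ℕ) (T : Set (ℕ × ℕ × ℕ)) : Prop where
  subset : ∀ m ∈ T, IsMatch n m
  slot_team : ∀ k, 1 ≤ k → k ≤ 2 * n - 2 → ∀ t, 1 ≤ t → t ≤ n →
      ∃! m : ℕ × ℕ × ℕ, m ∈ T ∧ m.1 = k ∧ (t = m.2.1 ∨ t = m.2.2)
  pair : ∀ i j, 1 ≤ i → i ≤ n → 1 ≤ j → j ≤ n → i ≠ j → ∃! k : ℕ, (k, i, j) ∈ T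

/-- The venue of team `t` in slot `k`: the home venue of the (unique) match of `t` in
slot `k`, and `t` itself if `t` has no match in slot `k` (in particular in the artificial
slots `0` and `2n-1`). -/
noncomputable def venue (T : Set (ℕ × ℕ × ℕ)) (t k : ℕ) : ℕ :=
  if h : ∃ i, ∃ j, (k, i, j) ∈ T ∧ (t = i ∨ t = j) then h.choose else t

/-- The travel vector `ψ(T)`: `travel n T (t,i,j) = 1` iff for some `0 ≤ k ≤ 2n-2` team `t`
has venue `i` in slot `k` and venue `j` in slot `k+1`. -/
noncomputable def travel (n : ℕ) (T : Set (ℕ × ℕ × ℕ)) (p : ℕ × ℕ × ℕ) : ℝ :=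
  if ∃ k, k ≤ 2 * n - 2 ∧ venue T p.1 k = p.2.1 ∧ venue T p.1 (k + 1) = p.2.2 then 1 else 0

/-- The play vector `χ(T)`: characteristic vector of `T`. -/
noncomputable def play (T : Set (ℕ × ℕ × ℕ)) (m : ℕ × ℕ × ℕ) : ℝ :=
  if m ∈ T then 1 else 0

/-- The ambient space `ℝ^M × ℝ^{V×A}`. -/
abbrev Pt (n : ℕ) :=
  ({m : ℕ × ℕ × ℕ // IsMatch n m} → ℝ) × ({p : ℕ × ℕ × ℕ // IsTravelIdx n p} → ℝ)

/-- The play coordinate `x_{k,i,j}` of a point (0 at invalid indices). -/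
noncomputable def xval {n : ℕ} (z : Pt n) (k i j : ℕ) : ℝ :=
  if h : IsMatch n (k, i, j) then z.1 ⟨(k, i, j), h⟩ else 0

/-- The travel coordinate `y_{t,i,j}` of a point (0 at invalid indices). -/
noncomputable def yval {n : ℕ} (z : Pt n) (t i j : ℕ) : ℝ :=
  if h : IsTravelIdx n (t, i, j) then z.2 ⟨(t, i, j), h⟩ else 0

/-- The unconstrained traveling tournament polytope `Ptt(n)`:
the convex hull of all pairs `(χ(T), y)` with `T` a tournament and `y ∈ {0,1}^{V×A}`,
`y ≥ ψ(T)` componentwise. -/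
def Ptt (n : ℕ) : Set (Pt n) :=
  convexHull ℝ { z : Pt n | ∃ T : Set (ℕ × ℕ × ℕ), IsTournament n T ∧
    (∀ m : {m : ℕ × ℕ × ℕ // IsMatch n m}, z.1 m = play T m.1) ∧
    (∀ p : {p : ℕ × ℕ × ℕ // IsTravelIdx n p}, z.2 p = 0 ∨ z.2 p = 1) ∧
    (∀ p : {p : ℕ × ℕ × ℕ // IsTravelIdx n p}, travel n T p.1 ≤ z.2 p) }

/-- Dimension of the affine hull of a set. -/
noncomputable def adim {n : ℕ} (s : Set (Pt n)) : ℕ :=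
  Module.finrank ℝ (affineSpan ℝ s).direction

/-- A valid inequality `f z ≤ γ` is facet-defining for `Ptt(n)`:
it holds on `Ptt(n)` and its face has dimension `dim Ptt(n) - 1`. -/
def IsFacetLE {n : ℕ} (f : Pt n → ℝ) (γ : ℝ) : Prop :=
  (∀ z ∈ Ptt n, f z ≤ γ) ∧ adim {z ∈ Ptt n | f z = γ} + 1 = adim (Ptt n)

/-- A valid inequality `f z ≥ γ` is facet-defining for `Ptt(n)`:
it holds on `Ptt(n)` and its face has dimension `dim Ptt(n) - 1`. -/
def IsFacetGE {n : ℕ} (f : Pt n → ℝ) (γ : ℝ) : Prop :=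
  (∀ z ∈ Ptt n, γ ≤ f z) ∧ adim {z ∈ Ptt n | f z = γ} + 1 = adim (Ptt n)

theorem indicator_sum_sub_one_le {p q r : Prop} {y : ℝ} (hy : 0 ≤ y) (hpq : p → ¬q)
    (hpr : p → ¬r) (hqr : q → r → 1 ≤ y) :
    (if p then (1 : ℝ) else 0) + (if q then 1 else 0) + (if r then 1 else 0) - 1 ≤ y := by
  by_cases hp : p
  · simp [hp, hpq hp, hpr hp, hy]
  by_cases hq : q <;> by_cases hr : r <;> simp [hp, hq, hr, hy]
  · linarith [hqr hq hr]
  · linarith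

theorem xval_combo {n : ℕ} (z w : Pt n) (a b : ℝ) (k i j : ℕ) :
    xval (a • z + b • w) k i j = a * xval z k i j + b * xval w k i j := by
  unfold xval
  split_ifs <;> simp

theorem yval_combo {n : ℕ} (z w : Pt n) (a b : ℝ) (t i j : ℕ) :
    yval (a • z + b • w) t i j = a * yval z t i j + b * yval w t i j := by
  unfold yval
  split_ifs <;> simp

/-- If a point carries the play vector of a tournament, its extended play coordinates are
membership indicators, at invalid indices as well. -/
theorem IsTournament.xval_eq {n : ℕ} {T : Set (ℕ × ℕ × ℕ)} (hT : IsTournament n T) {z : Pt n}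
    (hz : ∀ m : {m : ℕ × ℕ × ℕ // IsMatch n m}, z.1 m = play T m.1) (k i j : ℕ) :
    xval z k i j = if (k, i, j) ∈ T then 1 else 0 := by
  unfold xval
  split_ifs with h hm hm
  · rw [hz, play, if_pos hm]
  · rw [hz, play, if_neg hm]
  · exact absurd (hT.subset _ hm) h
  · rfl

/-- A team plays at most one match per slot. -/
theorem IsTournament.match_unique {n : ℕ} {T : Set (ℕ × ℕ × ℕ)} (hT : IsTournament n T)
    {k t i j i' j' : ℕ} (h : (k, i, j) ∈ T) (ht : t = i ∨ t = j)
    (h' : (k, i', j') ∈ T) (ht' : t = i' ∨ t = j') : i = i' ∧ j = j' := by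
  obtain ⟨hk1, hk2, hi1, hin, hj1, hjn, -⟩ := hT.subset _ h
  have ht1 : 1 ≤ t := by rcases ht with rfl | rfl <;> assumption
  have htn : t ≤ n := by rcases ht with rfl | rfl <;> assumption
  have he := (hT.slot_team k hk1 hk2 t ht1 htn).unique ⟨h, rfl, ht⟩ ⟨h', rfl, ht'⟩
  simpa using he

/-- Every ordered pair of teams meets in at most one slot. -/
theorem IsTournament.slot_unique {n : ℕ} {T : Set (ℕ × ℕ × ℕ)} (hT : IsTournament n T)
    {k l i j : ℕ} (h : (k, i, j) ∈ T) (h' : (l, i, j) ∈ T) : k = l := by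
  obtain ⟨-, -, hi1, hin, hj1, hjn, hij⟩ := hT.subset _ h
  exact (hT.pair i j hi1 hin hj1 hjn hij).unique h h'

theorem IsTournament.venue_eq {n : ℕ} {T : Set (ℕ × ℕ × ℕ)} (hT : IsTournament n T)
    {k t i j : ℕ} (h : (k, i, j) ∈ T) (ht : t = i ∨ t = j) : venue T t k = i := by
  have hex : ∃ i, ∃ j, (k, i, j) ∈ T ∧ (t = i ∨ t = j) := ⟨i, j, h, ht⟩
  rw [venue, dif_pos hex]
  obtain ⟨j', h', ht'⟩ := hex.choose_spec
  exact (hT.match_unique h' ht' h ht).1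

/-- Consecutive away matches of `t` at `i` and `j` force the travel from `i` to `j`. -/
theorem IsTournament.travel_eq_one {n : ℕ} {T : Set (ℕ × ℕ × ℕ)} (hT : IsTournament n T)
    {k t i j : ℕ} (hi : (k, i, t) ∈ T) (hj : (k + 1, j, t) ∈ T) : travel n T (t, i, j) = 1 :=
  if_pos ⟨k, (hT.subset _ hi).2.1, hT.venue_eq hi (Or.inr rfl), hT.venue_eq hj (Or.inr rfl)⟩

/-- validity of the two lifted away-away inequalities. -/
theorem lifted_away_away_valid (n : ℕ) (hn : 4 ≤ n) (heven : Even n)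
    (k : ℕ) (hk1 : 1 ≤ k) (hk2 : k ≤ 2 * n - 2) (hk3 : k ≠ 2 * n - 2)
    (i j : ℕ) (hi1 : 1 ≤ i) (hin : i ≤ n) (hj1 : 1 ≤ j) (hjn : j ≤ n) (hij : i ≠ j)
    (t : ℕ) (ht1 : 1 ≤ t) (htn : t ≤ n) (hti : t ≠ i) (htj : t ≠ j) :
    ∀ z ∈ Ptt n,
      xval z k j t + xval z k i t + xval z (k + 1) j t - 1 ≤ yval z t i j ∧
      xval z (k + 1) i t + xval z k i t + xval z (k + 1) j t - 1 ≤ yval z t i j := by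
  intro z hz
  refine convexHull_min (t := {z : Pt n |
      xval z k j t + xval z k i t + xval z (k + 1) j t - 1 ≤ yval z t i j ∧
      xval z (k + 1) i t + xval z k i t + xval z (k + 1) j t - 1 ≤ yval z t i j}) ?_ ?_ hz
  · rintro w ⟨T, hT, hx, hy01, hy⟩
    have hidx : IsTravelIdx n (t, i, j) := ⟨ht1, htn, hi1, hin, hj1, hjn, hij⟩
    have hyval : yval w t i j = w.2 ⟨(t, i, j), hidx⟩ := dif_pos hidx
    have hnonneg : 0 ≤ yval w t i j := by
      rw [hyval]
      rcases hy01 ⟨(t, i, j), hidx⟩ with h | h <;> simp [h]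
    have htravel : (k, i, t) ∈ T → (k + 1, j, t) ∈ T → 1 ≤ yval w t i j := fun h₁ h₂ ↦ by
      rw [hyval, ← hT.travel_eq_one h₁ h₂]
      exact hy ⟨(t, i, j), hidx⟩
    have hvenue (l : ℕ) (h₁ : (l, i, t) ∈ T) (h₂ : (l, j, t) ∈ T) : False :=
      hij (hT.match_unique h₁ (Or.inr rfl) h₂ (Or.inr rfl)).1
    have hslot (v : ℕ) (h₁ : (k, v, t) ∈ T) (h₂ : (k + 1, v, t) ∈ T) : False :=
      k.succ_ne_self (hT.slot_unique h₁ h₂).symm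
    simp only [Set.mem_ofPred_eq, hT.xval_eq hx]
    exact ⟨indicator_sum_sub_one_le hnonneg (fun h₁ h₂ ↦ hvenue k h₂ h₁) (hslot j) htravel,
      indicator_sum_sub_one_le hnonneg (fun h₁ h₂ ↦ hslot i h₂ h₁) (hvenue (k + 1)) htravel⟩
  · rintro u ⟨hu₁, hu₂⟩ v ⟨hv₁, hv₂⟩ a b ha hb hab
    simp only [Set.mem_ofPred_eq, xval_combo, yval_combo]
    obtain rfl : b = 1 - a := by linarith
    constructor
    · linarith [mul_le_mul_of_nonneg_left hu₁ ha, mul_le_mul_of_nonneg_left hv₁ hb]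
    · linarith [mul_le_mul_of_nonneg_left hu₂ ha, mul_le_mul_of_nonneg_left hv₂ hb]

end TTP
end

section
/- For every slot k ∈ S∖{2n−2} and all pairwise distinct teams i,j,t ∈ V, both lifted inequalities x_{k,j,t} + x_{k,i,t} + x_{k+1,j,t} − 1 ≤ y_{t,i,j} and x_{k+1,i,t} + x_{k,i,t} + x_{k+1,j,t} − 1 ≤ y_{t,i,j} are facet-defining for Ptt(n). -/
open Finset

attribute [local instance] Classical.propDecidable

namespace TTP

section Schedules

variable {V S : Type*}

/-- `τ u v` is the slot of the match of `u` and `v` at venue `u`; distinct matches with a common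
team take place in distinct slots. Values on the diagonal are irrelevant. -/
def IsSched (τ : V → V → S) : Prop :=
  ∀ u v u' v', u ≠ v → u' ≠ v' → (u = u' ∨ u = v' ∨ v = u' ∨ v = v') →
    τ u v = τ u' v' → u = u' ∧ v = v'

/-- Teams `u` and `v` meet in slot `s`, at either venue. -/
def Meets (τ : V → V → S) (s : S) (u v : V) : Prop := τ u v = s ∨ τ v u = s

/-- Exchange the two matches of `u` and `v`. -/
noncomputable def swapVenues (u v : V) (τ : V → V → S) : V → V → S := fun x y =>
  if (x = u ∧ y = v) ∨ (x = v ∧ y = u) then τ y x else τ x y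

/-- A perfect matching, given as a fixed-point-free involution. -/
def IsPM (σ : Equiv.Perm V) : Prop := (∀ u, σ (σ u) = u) ∧ ∀ u, σ u ≠ u

theorem Meets.symm {τ : V → V → S} {s : S} {u v : V} (h : Meets τ s u v) : Meets τ s v u :=
  Or.symm h

theorem IsSched.swap {τ : V → V → S} (h : IsSched τ) (u v : V) : IsSched (swapVenues u v τ) := by
  intro a b a' b' hab hab' hs he
  unfold TTP.swapVenues at he
  have := h a b a' b' hab hab' hs
  have := h b a a' b' hab.symm hab' (by tauto)
  have := h a b b' a' hab hab'.symm (by tauto)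
  have := h b a b' a' hab.symm hab'.symm (by tauto)
  split_ifs at he <;> grind

theorem IsSched.comp {τ : V → V → S} (h : IsSched τ) (π : Equiv.Perm S) :
    IsSched (fun u v => π (τ u v)) :=
  fun a b a' b' hab hab' hs he => h a b a' b' hab hab' hs (π.injective he)

@[simp] theorem swapVenues_left (u v : V) (τ : V → V → S) : swapVenues u v τ u v = τ v u := by
  simp [swapVenues]

@[simp] theorem swapVenues_right (u v : V) (τ : V → V → S) : swapVenues u v τ v u = τ u v := by
  simp [swapVenues]

theorem swapVenues_of_ne {u v x y : V} (τ : V → V → S) (h : ¬ ((x = u ∧ y = v) ∨ (x = v ∧ y = u))) :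
    swapVenues u v τ x y = τ x y := by
  simp [swapVenues, h]

theorem meets_swapVenues {u v : V} {τ : V → V → S} {s : S} {x y : V} :
    Meets (swapVenues u v τ) s x y ↔ Meets τ s x y := by
  unfold Meets swapVenues
  split_ifs <;> grind

theorem IsSched.ne {τ : V → V → S} (h : IsSched τ) {u v : V} (huv : u ≠ v) : τ u v ≠ τ v u :=
  fun he => huv (h u v v u huv huv.symm (by simp) he).1

theorem IsSched.opp_unique {τ : V → V → S} (h : IsSched τ) {s : S} {u v w : V} (hv : v ≠ u)
    (hw : w ≠ u) (h1 : Meets τ s u v) (h2 : Meets τ s u w) : v = w := by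
  rcases h1 with h1 | h1 <;> rcases h2 with h2 | h2
  · exact (h u v u w hv.symm hw.symm (by simp) (h1.trans h2.symm)).2
  · exact absurd (h u v w u hv.symm hw (by simp) (h1.trans h2.symm)).2 hv
  · exact absurd (h v u u w hv hw.symm (by simp) (h1.trans h2.symm)).1 hv
  · exact (h v u w u hv hw (by simp) (h1.trans h2.symm)).1

/-- There is a schedule in which the match at slot `s` can be given either orientation. -/
theorem IsSched.exists_oriented {τ : V → V → S} (h : IsSched τ) {s : S} {u v : V}
    (hm : Meets τ s u v) :
    ∃ τ' : V → V → S, IsSched τ' ∧ τ' u v = s ∧ (∀ r x y, Meets τ' r x y ↔ Meets τ r x y) ∧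
      ∀ x y, ¬ ((x = u ∧ y = v) ∨ (x = v ∧ y = u)) → τ' x y = τ x y := by
  rcases hm with hm | hm
  · exact ⟨τ, h, hm, fun _ _ _ => Iff.rfl, fun _ _ _ => rfl⟩
  · exact ⟨swapVenues u v τ, h.swap u v, by simpa using hm, fun _ _ _ => meets_swapVenues,
      fun _ _ hxy => swapVenues_of_ne τ hxy⟩

theorem IsPM.conj {σ : Equiv.Perm V} (h : IsPM σ) (π : Equiv.Perm V) : IsPM (π⁻¹ * σ * π) := by
  refine ⟨fun u => by simp [h.1], fun u hu => h.2 (π u) ?_⟩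
  exact π.symm_apply_eq.1 hu

theorem exists_perm_three [Fintype S] {a b c a' b' c' : S} (hab : a ≠ b) (hac : a ≠ c) (hbc : b ≠ c)
    (hab' : a' ≠ b') (hac' : a' ≠ c') (hbc' : b' ≠ c') :
    ∃ π : Equiv.Perm S, π a = a' ∧ π b = b' ∧ π c = c' := by
  obtain ⟨g, hg⟩ := Finset.exists_equiv_extend_of_card_eq (α := S) (t := (univ : Finset S))
    (by simp) (s := {a, b, c}) (f := fun x => if x = a then a' else if x = b then b' else c')
    (by simp) (by
      intro x hx y hy hxy
      simp only [coe_insert, coe_singleton, Set.mem_insert_iff, Set.mem_singleton_iff] at hx hy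
      grind)
  refine ⟨g.trans (Equiv.subtypeUnivEquiv (by simp)), ?_, ?_, ?_⟩
  · simpa using hg a (by simp)
  · simpa [hab.symm] using hg b (by simp)
  · simpa [hac.symm, hbc.symm] using hg c (by simp)

variable [Fintype V]

theorem IsSched.exists_opp [Fintype S] {τ : V → V → S} (h : IsSched τ)
    (hc : Fintype.card S = 2 * Fintype.card V - 2) (s : S) (u : V) :
    ∃ v, v ≠ u ∧ Meets τ s u v := by
  let F : {v : V // v ≠ u} ⊕ {v : V // v ≠ u} → S :=
    Sum.elim (fun v => τ u v) (fun v => τ v u)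
  have hF : Function.Injective F := by
    rintro (⟨v, hv⟩ | ⟨v, hv⟩) (⟨w, hw⟩ | ⟨w, hw⟩) he <;>
      simp only [F, Sum.elim_inl, Sum.elim_inr] at he
    · have := h u v u w hv.symm hw.symm (by simp) he
      simp [this.2]
    · exact absurd (h u v w u hv.symm hw (by simp) he).2 hv
    · exact absurd (h v u u w hv hw.symm (by simp) he).1 hv
    · have := h v u w u hv hw (by simp) he
      simp [this.1]
  have hb : Function.Bijective F := by
    rw [Fintype.bijective_iff_injective_and_card]
    refine ⟨hF, ?_⟩
    rw [Fintype.card_sum, Fintype.card_subtype_compl, Fintype.card_subtype_eq, hc]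
    omega
  obtain ⟨v | v, hv⟩ := hb.2 s
  · exact ⟨v, v.2, Or.inl hv⟩
  · exact ⟨v, v.2, Or.inr hv⟩

theorem IsSched.exists_matching [Fintype S] {τ : V → V → S} (h : IsSched τ)
    (hc : Fintype.card S = 2 * Fintype.card V - 2) (s : S) :
    ∃ σ : Equiv.Perm V, IsPM σ ∧ ∀ u, Meets τ s u (σ u) := by
  choose o ho hm using h.exists_opp hc s
  have hinv : Function.Involutive o := fun u =>
    h.opp_unique (ho _) (ho u).symm (hm _) (hm u).symm
  exact ⟨hinv.toPerm, ⟨hinv, ho⟩, hm⟩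

/-! ### Proper edge colourings and perfect matchings -/

/-- A proper edge colouring of the complete graph on `V`. -/
def IsColoring {R : Type*} (c : V → V → R) : Prop :=
  (∀ u v, c u v = c v u) ∧ ∀ u v w, v ≠ u → w ≠ u → c u v = c u w → v = w

theorem exists_coloring (he : Even (Fintype.card V)) (hV : 4 ≤ Fintype.card V) :
    ∃ c : V → V → ZMod (Fintype.card V - 1), IsColoring c ∧
      ∃ σ : Equiv.Perm V, IsPM σ ∧ ∀ u, c u (σ u) = 0 := by
  obtain ⟨m, hm⟩ := he
  obtain ⟨q, hq⟩ : ∃ q, Fintype.card V = q + 1 := ⟨Fintype.card V - 1, by omega⟩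
  rw [hq, Nat.add_sub_cancel]
  have hq0 : NeZero q := ⟨by omega⟩
  have two : ∀ x y : ZMod q, x + x = y + y → x = y := by
    intro x y hxy
    have hu : IsUnit ((2 : ℕ) : ZMod q) := by
      rw [ZMod.isUnit_iff_coprime]
      exact (Nat.coprime_two_left (n := q)).2 (by rw [Nat.odd_iff]; omega)
    refine hu.mul_left_cancel ?_
    push_cast
    linear_combination hxy
  obtain ⟨e⟩ : Nonempty (V ≃ Option (ZMod q)) := by
    rw [← Fintype.card_eq, Fintype.card_option, ZMod.card, hq]
  let c : Option (ZMod q) → Option (ZMod q) → ZMod q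
    | none, none => 0
    | none, some x => x + x
    | some x, none => x + x
    | some x, some y => x + y
  let o : Option (ZMod q) → Option (ZMod q)
    | none => some 0
    | some x => if x = 0 then none else some (-x)
  have ho : Function.Involutive o := by
    rintro (_ | x)
    · simp [o]
    · by_cases hx : x = 0 <;> simp [o, hx]
  have ho' : ∀ x, o x ≠ x := by
    rintro (_ | x)
    · simp [o]
    · by_cases hx : x = 0
      · simp [o, hx]
      · simp only [o, hx, if_false, ne_eq, Option.some.injEq]
        intro h
        exact hx (two x 0 (by linear_combination -h))
  have hco : ∀ x, c x (o x) = 0 := by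
    rintro (_ | x)
    · simp [o, c]
    · by_cases hx : x = 0 <;> simp [o, c, hx]
  have hcs : ∀ x y, c x y = c y x := by
    rintro (_ | x) (_ | y) <;> simp [c, add_comm]
  have hcp : ∀ x y z, y ≠ x → z ≠ x → c x y = c x z → y = z := by
    rintro (_ | x) (_ | y) (_ | z) <;> simp [c]
    · exact two y z
    · intro h1 h2
      exact absurd h2.symm h1
  refine ⟨fun u v => c (e u) (e v), ⟨fun u v => hcs _ _, fun u v w hv hw h => e.injective
      (hcp _ _ _ (e.injective.ne hv) (e.injective.ne hw) h)⟩,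
    (e.trans ho.toPerm).trans e.symm, ⟨fun u => ?_, fun u => ?_⟩, fun u => ?_⟩
  · simp [ho (e u)]
  · simpa [Equiv.symm_apply_eq] using ho' (e u)
  · simpa using hco (e u)

theorem IsPM.cycleType {σ : Equiv.Perm V} (h : IsPM σ) (hV : 4 ≤ Fintype.card V) :
    σ.cycleType = Multiset.replicate (Fintype.card V / 2) 2 := by
  have hσ : σ ^ 2 = 1 := by
    ext u
    simp [pow_two, h.1]
  have hne : σ ≠ 1 := by
    rintro rfl
    obtain ⟨u⟩ : Nonempty V := Fintype.card_pos_iff.1 (by omega)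
    exact h.2 u rfl
  have ho : orderOf σ = 2 := orderOf_eq_prime hσ hne
  obtain ⟨m, hm⟩ := Equiv.Perm.cycleType_prime_order (σ := σ) (by rw [ho]; exact Nat.prime_two)
  have hs := Equiv.Perm.sum_cycleType σ
  have hsup : σ.support = univ := by
    ext u
    simp [h.2 u]
  rw [hsup, hm, ho, card_univ] at hs
  simp at hs
  rw [hm, ho]
  congr 1
  omega

theorem IsPM.exists_coloring {σ : Equiv.Perm V} (h : IsPM σ) (he : Even (Fintype.card V))
    (hV : 4 ≤ Fintype.card V) :
    ∃ c : V → V → ZMod (Fintype.card V - 1), IsColoring c ∧ ∀ u, c u (σ u) = 0 := by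
  obtain ⟨c, hc, σ₀, h₀, hc₀⟩ := TTP.exists_coloring he hV
  obtain ⟨π, hπ⟩ := isConj_iff.1
    (Equiv.Perm.isConj_iff_cycleType_eq.2 ((h.cycleType hV).trans (h₀.cycleType hV).symm))
  refine ⟨fun u v => c (π u) (π v), ⟨fun u v => hc.1 _ _, fun u v w hv hw huv => ?_⟩, fun u => ?_⟩
  · exact π.injective (hc.2 _ _ _ (π.injective.ne hv) (π.injective.ne hw) huv)
  · have := hc₀ (π u)
    rw [← hπ] at this
    simpa using this

theorem exists_isPM (he : Even (Fintype.card V)) (hV : 4 ≤ Fintype.card V) :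
    ∃ σ : Equiv.Perm V, IsPM σ :=
  let ⟨_, _, σ, hσ, _⟩ := TTP.exists_coloring he hV
  ⟨σ, hσ⟩


theorem exists_sched_of_colorings {R : Type*} {c c' : V → V → R} (hc : IsColoring c)
    (hc' : IsColoring c') (e : R ⊕ R ≃ S) :
    ∃ τ : V → V → S, IsSched τ ∧ (∀ u v, u ≠ v → Meets τ (e (.inl (c u v))) u v) ∧
      ∀ u v, u ≠ v → Meets τ (e (.inr (c' u v))) u v := by
  let o := Fintype.equivFin V
  refine ⟨fun u v => if o u < o v then e (.inl (c u v)) else e (.inr (c' u v)), ?_, ?_, ?_⟩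
  · intro u v u' v' huv huv' hs he
    have key : ∀ {d : V → V → R}, IsColoring d → d u v = d u' v' →
        (u = u' ∧ v = v') ∨ (u = v' ∧ v = u') := by
      intro d hd h
      have h1 := hd.1
      have h2 := hd.2
      rcases hs with rfl | rfl | rfl | rfl
      · exact Or.inl ⟨rfl, h2 _ _ _ huv.symm huv'.symm h⟩
      · exact Or.inr ⟨rfl, h2 _ _ _ huv.symm huv' (h.trans (h1 _ _))⟩
      · exact Or.inr ⟨h2 _ _ _ huv huv'.symm ((h1 _ _).trans h), rfl⟩
      · exact Or.inl ⟨h2 _ _ _ huv huv' ((h1 _ _).trans (h.trans (h1 _ _))), rfl⟩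
    have hne : ∀ x y, x ≠ y → o x ≠ o y := fun x y h => o.injective.ne h
    dsimp only at he
    split_ifs at he with h1 h2 h2
    · rcases key hc (by simpa using he) with h | ⟨rfl, rfl⟩
      · exact h
      · exact absurd h2 h1.asymm
    · simp at he
    · simp at he
    · rcases key hc' (by simpa using he) with h | ⟨rfl, rfl⟩
      · exact h
      · exact absurd (le_antisymm (not_lt.1 h1) (not_lt.1 h2)) (hne _ _ huv.symm)
  · intro u v huv
    rcases lt_or_gt_of_ne (o.injective.ne huv) with h | h
    · exact Or.inl (by simp [h])
    · exact Or.inr (by simp [h, hc.1 u v])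
  · intro u v huv
    rcases lt_or_gt_of_ne (o.injective.ne huv) with h | h
    · exact Or.inr (by simp [h.le, hc'.1 u v])
    · exact Or.inl (by simp [h.le])

/-- Two perfect matchings in prescribed slots, and a further prescribed meeting. -/
theorem exists_sched_of_matchings [Fintype S] (hc : Fintype.card S = 2 * Fintype.card V - 2)
    (he : Even (Fintype.card V)) (hV : 4 ≤ Fintype.card V) {σ σ' : Equiv.Perm V} (hσ : IsPM σ)
    (hσ' : IsPM σ') {l m k : S} (hlm : l ≠ m) (hkl : k ≠ l) (hkm : k ≠ m) {x y : V} (hxy : x ≠ y)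
    (hn : ¬ (σ x = y ∧ σ' x = y)) :
    ∃ τ : V → V → S, IsSched τ ∧ (∀ u, Meets τ l u (σ u)) ∧ (∀ u, Meets τ m u (σ' u)) ∧
      Meets τ k x y := by
  obtain ⟨c, hcc, hc0⟩ := hσ.exists_coloring he hV
  obtain ⟨c', hcc', hc0'⟩ := hσ'.exists_coloring he hV
  have hq : NeZero (Fintype.card V - 1) := ⟨by omega⟩
  obtain ⟨e₀⟩ : Nonempty (ZMod (Fintype.card V - 1) ⊕ ZMod (Fintype.card V - 1) ≃ S) := by
    rw [← Fintype.card_eq, Fintype.card_sum, ZMod.card, hc]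
    omega
  have hr : ∃ r : ZMod (Fintype.card V - 1) ⊕ ZMod (Fintype.card V - 1),
      r ≠ .inl 0 ∧ r ≠ .inr 0 ∧ (r = .inl (c x y) ∨ r = .inr (c' x y)) := by
    by_cases h : σ x = y
    · refine ⟨.inr (c' x y), by simp, ?_, Or.inr rfl⟩
      simp only [ne_eq, Sum.inr.injEq]
      intro h0
      exact hn ⟨h, hcc'.2 x _ _ (hσ'.2 x) hxy.symm ((hc0' x).trans h0.symm)⟩
    · refine ⟨.inl (c x y), ?_, by simp, Or.inl rfl⟩
      simp only [ne_eq, Sum.inl.injEq]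
      intro h0
      exact h (hcc.2 x _ _ (hσ.2 x) hxy.symm ((hc0 x).trans h0.symm))
  obtain ⟨r, hr1, hr2, hr3⟩ := hr
  obtain ⟨π, hπ1, hπ2, hπ3⟩ := exists_perm_three (a := e₀ (.inl 0)) (b := e₀ (.inr 0)) (c := e₀ r)
    (by simp) (e₀.injective.ne hr1.symm) (e₀.injective.ne hr2.symm) hlm hkl.symm hkm.symm
  obtain ⟨τ, hτ, h1, h2⟩ := exists_sched_of_colorings hcc hcc' (e₀.trans π)
  refine ⟨τ, hτ, fun u => ?_, fun u => ?_, ?_⟩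
  · simpa [hc0, hπ1] using h1 u (σ u) (hσ.2 u).symm
  · simpa [hc0', hπ2] using h2 u (σ' u) (hσ'.2 u).symm
  · rcases hr3 with rfl | rfl
    · simpa [hπ3] using h1 x y hxy
    · simpa [hπ3] using h2 x y hxy

/-- The perfect matching through a given edge. -/
theorem exists_isPM_edge (he : Even (Fintype.card V)) (hV : 4 ≤ Fintype.card V) {u v : V}
    (huv : u ≠ v) : ∃ σ : Equiv.Perm V, IsPM σ ∧ σ u = v := by
  obtain ⟨σ, hσ⟩ := exists_isPM he hV
  refine ⟨_, hσ.conj (Equiv.swap v (σ u)), ?_⟩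
  simp [Equiv.swap_apply_of_ne_of_ne huv (hσ.2 u).symm]

/-- A perfect matching through two disjoint given edges. -/
theorem exists_isPM_edges (he : Even (Fintype.card V)) (hV : 4 ≤ Fintype.card V) {u v x y : V}
    (huv : u ≠ v) (hxy : x ≠ y) (hux : u ≠ x) (huy : u ≠ y) (hvx : v ≠ x) (hvy : v ≠ y) :
    ∃ σ : Equiv.Perm V, IsPM σ ∧ σ u = v ∧ σ x = y := by
  obtain ⟨σ, hσ, h⟩ := exists_isPM_edge he hV huv
  have h1 : σ x ≠ u := fun h' => hvx (by rw [← h, ← h', hσ.1])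
  have h2 : σ x ≠ v := fun h' => hux (σ.injective (h.trans h'.symm))
  refine ⟨_, hσ.conj (Equiv.swap y (σ x)), ?_, ?_⟩
  · simp [Equiv.swap_apply_of_ne_of_ne huy h1.symm, h, Equiv.swap_apply_of_ne_of_ne hvy h2.symm]
  · simp [Equiv.swap_apply_of_ne_of_ne hxy (hσ.2 x).symm]

theorem exists_ne_ne (hV : 3 ≤ Fintype.card V) (x y : V) : ∃ z, z ≠ x ∧ z ≠ y := by
  obtain ⟨z, hz⟩ : ∃ z, z ∉ ({x, y} : Finset V) := by
    by_contra! h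
    have := Finset.card_le_two (a := x) (b := y)
    rw [Finset.eq_univ_of_forall h, card_univ] at this
    omega
  exact ⟨z, by simpa using hz⟩

theorem exists_sched_of_two_matchings [Fintype S] (hc : Fintype.card S = 2 * Fintype.card V - 2)
    (he : Even (Fintype.card V)) (hV : 4 ≤ Fintype.card V) {σ σ' : Equiv.Perm V} (hσ : IsPM σ)
    (hσ' : IsPM σ') {l m : S} (hlm : l ≠ m) :
    ∃ τ : V → V → S, IsSched τ ∧ (∀ u, Meets τ l u (σ u)) ∧ ∀ u, Meets τ m u (σ' u) := by
  obtain ⟨x⟩ : Nonempty V := Fintype.card_pos_iff.1 (by omega)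
  obtain ⟨y, hy, hy'⟩ := exists_ne_ne (by omega) x (σ x)
  obtain ⟨k, hk, hk'⟩ := exists_ne_ne (by omega) l m
  obtain ⟨τ, h1, h2, h3, -⟩ := exists_sched_of_matchings hc he hV hσ hσ' hlm hk hk' hy.symm
    (fun h => hy' h.1.symm)
  exact ⟨τ, h1, h2, h3⟩

/-! ### Weights of schedules -/

/-- Total weight of the matches of a schedule. -/
noncomputable def weight (a : S → V → V → ℝ) (τ : V → V → S) : ℝ :=
  ∑ p ∈ (univ : Finset V).offDiag, a (τ p.1 p.2) p.1 p.2

theorem weight_swapVenues {a : S → V → V → ℝ} {τ : V → V → S} {u v : V} (huv : u ≠ v)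
    (h : weight a (swapVenues u v τ) = weight a τ) :
    a (τ u v) u v - a (τ u v) v u = a (τ v u) u v - a (τ v u) v u := by
  rw [← sub_eq_zero, weight, weight, ← Finset.sum_sub_distrib,
    ← Finset.sum_subset (s₁ := {(u, v), (v, u)})] at h
  · rw [Finset.sum_pair (by simp [huv])] at h
    simp only [swapVenues_left, swapVenues_right] at h
    linarith
  · intro p hp
    simp only [mem_insert, mem_singleton] at hp
    rcases hp with rfl | rfl <;> simp [huv, huv.symm]
  · intro p _ hp
    rw [swapVenues_of_ne, sub_self]
    simpa [Prod.ext_iff] using hp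

theorem sum_offDiag_swap (g : V → V → ℝ) :
    ∑ p ∈ (univ : Finset V).offDiag, g p.2 p.1 = ∑ p ∈ (univ : Finset V).offDiag, g p.1 p.2 := by
  refine Finset.sum_nbij' Prod.swap Prod.swap ?_ ?_ ?_ ?_ ?_ <;> simp [eq_comm]

theorem sum_offDiag (g : V → V → ℝ) :
    ∑ p ∈ (univ : Finset V).offDiag, g p.1 p.2 = ∑ u, ∑ v, if u ≠ v then g u v else 0 := by
  rw [← Finset.sum_product', ← Finset.sum_filter]
  refine Finset.sum_congr ?_ fun _ _ => rfl
  ext p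
  simp

/-- If the orientation-dependent part of the weights does not depend on the slot, the weights can be
symmetrized. -/
theorem weight_symmetrize {a : S → V → V → ℝ}
    (h : ∀ l m u v, u ≠ v → a l u v - a l v u = a m u v - a m v u) (τ : V → V → S) :
    weight a τ = weight (fun s u v => (a s u v + a s v u) / 2) τ := by
  have hd : ∑ p ∈ (univ : Finset V).offDiag, (a (τ p.1 p.2) p.1 p.2 - a (τ p.1 p.2) p.2 p.1) = 0 := by
    have h1 := sum_offDiag_swap fun u v => a (τ u v) u v - a (τ u v) v u
    have h2 : ∑ p ∈ (univ : Finset V).offDiag, (a (τ p.2 p.1) p.2 p.1 - a (τ p.2 p.1) p.1 p.2) =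
        -∑ p ∈ (univ : Finset V).offDiag, (a (τ p.1 p.2) p.1 p.2 - a (τ p.1 p.2) p.2 p.1) := by
      rw [← Finset.sum_neg_distrib]
      refine Finset.sum_congr rfl fun p hp => ?_
      rw [h _ (τ p.1 p.2) _ _ (mem_offDiag.1 hp).2.2.symm]
      ring
    linarith
  rw [← sub_eq_zero, weight, weight, ← Finset.sum_sub_distrib,
    ← mul_eq_zero_iff_left (two_ne_zero (α := ℝ)), Finset.mul_sum, ← hd]
  refine Finset.sum_congr rfl fun p _ => ?_
  ring

/-- The weight of a slot is computed by its perfect matching. -/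
theorem IsSched.sum_slot {τ : V → V → S} (h : IsSched τ) {s : S} {σ : Equiv.Perm V}
    (hσ : IsPM σ) (hm : ∀ u, Meets τ s u (σ u)) {g : V → V → ℝ} (hg : ∀ u v, g u v = g v u) :
    ∑ u, g u (σ u) = 2 * ∑ p ∈ (univ : Finset V).offDiag, if τ p.1 p.2 = s then g p.1 p.2 else 0 := by
  have h1 := sum_offDiag_swap fun u v => if τ u v = s then g u v else 0
  rw [two_mul]
  nth_rw 1 [← h1]
  rw [← Finset.sum_add_distrib,
    sum_offDiag fun u v => (if τ v u = s then g v u else 0) + if τ u v = s then g u v else 0]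
  refine Finset.sum_congr rfl fun u _ => ?_
  calc g u (σ u) = ∑ v, if v = σ u then g u v else 0 := by simp
    _ = _ := Finset.sum_congr rfl fun v _ => ?_
  · by_cases hv : v = σ u
    · subst hv
      have hne := (hσ.2 u).symm
      have h2 := h.ne hne
      rcases hm u with h3 | h3
      · have : τ (σ u) u ≠ s := fun h4 => h2 (h3.trans h4.symm)
        simp [hne, h3, this]
      · have : τ u (σ u) ≠ s := fun h4 => h2 (h4.trans h3.symm)
        simp [hne, h3, this, hg u]
    · rw [if_neg hv]
      split_ifs with h2 h3 h4 h4
      · exact absurd (h.opp_unique h2.symm (hσ.2 u) (Or.inr h3) (hm u)) hv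
      · exact absurd (h.opp_unique h2.symm (hσ.2 u) (Or.inr h3) (hm u)) hv
      · exact absurd (h.opp_unique h2.symm (hσ.2 u) (Or.inl h4) (hm u)) hv
      · simp
      · rfl

theorem weight_swapSlots {b : S → V → V → ℝ} (hb : ∀ s u v, b s u v = b s v u) {τ : V → V → S}
    (h : IsSched τ) {l m : S} (hlm : l ≠ m) {σ σ' : Equiv.Perm V} (hσ : IsPM σ) (hσ' : IsPM σ')
    (hl : ∀ u, Meets τ l u (σ u)) (hm : ∀ u, Meets τ m u (σ' u))
    (hw : weight b (fun u v => Equiv.swap l m (τ u v)) = weight b τ) :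
    ∑ u, (b l u (σ u) - b m u (σ u)) = ∑ u, (b l u (σ' u) - b m u (σ' u)) := by
  have hg : ∀ u v, b l u v - b m u v = b l v u - b m v u := fun u v => by rw [hb l, hb m]
  rw [h.sum_slot hσ hl (g := fun u v => b l u v - b m u v) hg,
    h.sum_slot hσ' hm (g := fun u v => b l u v - b m u v) hg, ← sub_eq_zero, ← mul_sub,
    ← Finset.sum_sub_distrib]
  rw [← sub_eq_zero, weight, weight, ← Finset.sum_sub_distrib] at hw
  refine mul_eq_zero.2 (Or.inr (neg_eq_zero.1 ?_))
  rw [← Finset.sum_neg_distrib]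
  refine (Finset.sum_congr rfl fun p _ => ?_).trans hw
  by_cases h1 : τ p.1 p.2 = l
  · simp [h1, hlm]
  · by_cases h2 : τ p.1 p.2 = m
    · simp [h2, hlm.symm]
    · simp [h1, h2, Equiv.swap_apply_of_ne_of_ne h1 h2]

theorem IsSched.two_mul_weight [Fintype S] {τ : V → V → S} (h : IsSched τ) {σ : S → Equiv.Perm V}
    (hσ : ∀ s, IsPM (σ s)) (hm : ∀ s u, Meets τ s u (σ s u)) {b : S → V → V → ℝ}
    (hb : ∀ s u v, b s u v = b s v u) : 2 * weight b τ = ∑ s, ∑ u, b s u (σ s u) := by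
  simp_rw [fun s => h.sum_slot (hσ s) (hm s) (hb s)]
  rw [← Finset.mul_sum, Finset.sum_comm, weight]
  simp

/-- If the differences of the weights of two slots do not distinguish perfect matchings, then all
schedules have the same weight. -/
theorem weight_eq_weight [Fintype S] (hc : Fintype.card S = 2 * Fintype.card V - 2)
    {b : S → V → V → ℝ} (hb : ∀ s u v, b s u v = b s v u)
    (hG : ∀ l m : S, ∀ σ σ' : Equiv.Perm V, IsPM σ → IsPM σ' →
      ∑ u, (b l u (σ u) - b m u (σ u)) = ∑ u, (b l u (σ' u) - b m u (σ' u)))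
    (s₀ : S) {τ τ' : V → V → S} (h : IsSched τ) (h' : IsSched τ') :
    weight b τ = weight b τ' := by
  choose σ hσ hm using h.exists_matching hc
  choose σ' hσ' hm' using h'.exists_matching hc
  have h1 := h.two_mul_weight hσ hm hb
  have h2 := h'.two_mul_weight hσ' hm' hb
  have h3 := h.two_mul_weight hσ hm (b := fun _ => b s₀) fun _ => hb s₀
  have h4 := h'.two_mul_weight hσ' hm' (b := fun _ => b s₀) fun _ => hb s₀
  have h5 : weight (fun _ => b s₀) τ = weight (fun _ => b s₀) τ' := rfl
  have h6 : ∑ s, ∑ u, (b s u (σ s u) - b s₀ u (σ s u)) =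
      ∑ s, ∑ u, (b s u (σ' s u) - b s₀ u (σ' s u)) :=
    Finset.sum_congr rfl fun s _ => hG s s₀ _ _ (hσ s) (hσ' s)
  simp only [Finset.sum_sub_distrib] at h6
  linarith

theorem orient_of_meets {a : S → V → V → ℝ} {τ : V → V → S} {u v : V} (huv : u ≠ v)
    {l m : S} (hlm : l ≠ m) (hl : Meets τ l u v) (hm : Meets τ m u v)
    (h : weight a (swapVenues u v τ) = weight a τ) :
    a l u v - a l v u = a m u v - a m v u := by
  have := weight_swapVenues huv h
  rcases hl with hl | hl <;> rcases hm with hm | hm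
  · exact absurd (hl.symm.trans hm) hlm
  · rwa [hl, hm] at this
  · rw [hl, hm] at this
    exact this.symm
  · exact absurd (hl.symm.trans hm) hlm

section Fixed

/-! Consequences of having constant weight on all schedules with a given match. -/

variable [Fintype S] {a : S → V → V → ℝ} {C : ℝ} {x y : V} {s₀ : S}

theorem orient_of_disjoint (hc : Fintype.card S = 2 * Fintype.card V - 2)
    (he : Even (Fintype.card V)) (hV : 4 ≤ Fintype.card V) (hxy : x ≠ y)
    (H : ∀ τ : V → V → S, IsSched τ → τ x y = s₀ → weight a τ = C)
    {u v : V} (huv : u ≠ v) (hux : u ≠ x) (huy : u ≠ y) (hvx : v ≠ x) (hvy : v ≠ y) (m : S) :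
    a m u v - a m v u = a s₀ u v - a s₀ v u := by
  rcases eq_or_ne m s₀ with rfl | hm
  · rfl
  obtain ⟨σ, hσ, h1, h2⟩ := exists_isPM_edges he hV huv hxy hux huy hvx hvy
  obtain ⟨τ, hτ, hl, hm'⟩ := exists_sched_of_two_matchings hc he hV hσ hσ hm.symm
  obtain ⟨τ', hτ', h3, h4, -⟩ := hτ.exists_oriented (h2 ▸ hl x)
  refine orient_of_meets huv hm ((h4 _ _ _).2 (h1 ▸ hm' u)) ((h4 _ _ _).2 (h1 ▸ hl u)) ?_
  rw [H _ (hτ'.swap u v) (by rw [swapVenues_of_ne _ (by tauto), h3]), H _ hτ' h3]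

theorem orient_of_inter (hc : Fintype.card S = 2 * Fintype.card V - 2)
    (he : Even (Fintype.card V)) (hV : 4 ≤ Fintype.card V) (hxy : x ≠ y)
    (H : ∀ τ : V → V → S, IsSched τ → τ x y = s₀ → weight a τ = C)
    {u v : V} (huv : u ≠ v) (hi : x = u ∨ x = v ∨ y = u ∨ y = v)
    (hne : ¬ ((x = u ∧ y = v) ∨ (x = v ∧ y = u))) {l m : S} (hl : l ≠ s₀) (hm : m ≠ s₀) :
    a l u v - a l v u = a m u v - a m v u := by
  rcases eq_or_ne l m with rfl | hlm
  · rfl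
  obtain ⟨σ, hσ, h1⟩ := exists_isPM_edge he hV huv
  have h2 : σ v = u := by rw [← h1, hσ.1]
  have h3 : σ x ≠ y := by
    intro h
    have := hσ.1 x
    grind
  obtain ⟨τ, hτ, hτl, hτm, hτx⟩ := exists_sched_of_matchings hc he hV hσ hσ hlm hl.symm hm.symm hxy
    (fun h => h3 h.1)
  obtain ⟨τ', hτ', h4, h5, -⟩ := hτ.exists_oriented hτx
  refine orient_of_meets huv hlm ((h5 _ _ _).2 (h1 ▸ hτl u)) ((h5 _ _ _).2 (h1 ▸ hτm u)) ?_
  rw [H _ (hτ'.swap u v) (by rw [swapVenues_of_ne _ hne, h4]), H _ hτ' h4]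

theorem matching_of_fixed (hc : Fintype.card S = 2 * Fintype.card V - 2)
    (he : Even (Fintype.card V)) (hV : 4 ≤ Fintype.card V) (hxy : x ≠ y)
    (ha : ∀ s u v, a s u v = a s v u)
    (H : ∀ τ : V → V → S, IsSched τ → τ x y = s₀ → weight a τ = C) {l m : S} (hl : l ≠ s₀)
    (hm : m ≠ s₀) {σ σ' : Equiv.Perm V} (hσ : IsPM σ) (hσ' : IsPM σ') :
    ∑ u, (a l u (σ u) - a m u (σ u)) = ∑ u, (a l u (σ' u) - a m u (σ' u)) := by
  rcases eq_or_ne l m with rfl | hlm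
  · simp
  have key : ∀ {ρ ρ' : Equiv.Perm V}, IsPM ρ → IsPM ρ' → ρ' x ≠ y →
      ∑ u, (a l u (ρ u) - a m u (ρ u)) = ∑ u, (a l u (ρ' u) - a m u (ρ' u)) := by
    intro ρ ρ' hρ hρ' hne
    obtain ⟨τ, hτ, hτl, hτm, hτx⟩ := exists_sched_of_matchings hc he hV hρ hρ' hlm hl.symm hm.symm hxy
      (fun h => hne h.2)
    obtain ⟨τ', hτ', h4, h5, -⟩ := hτ.exists_oriented hτx
    refine weight_swapSlots ha hτ' hlm hρ hρ' (fun u => (h5 _ _ _).2 (hτl u))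
      (fun u => (h5 _ _ _).2 (hτm u)) ?_
    rw [H _ (hτ'.comp _) (by rw [h4, Equiv.swap_apply_of_ne_of_ne hl.symm hm.symm]), H _ hτ' h4]
  obtain ⟨z, hzx, hzy⟩ := exists_ne_ne (by omega) x y
  obtain ⟨ρ, hρ, hρx⟩ := exists_isPM_edge he hV hzx.symm
  have hne : ρ x ≠ y := hρx ▸ hzy
  exact (key hσ hρ hne).trans (key hσ' hρ hne).symm

end Fixed

/-- The combinatorial core: weights that are constant on the schedules of the face are constant on
all schedules. -/
theorem weight_const_of_face [Fintype S] (hc : Fintype.card S = 2 * Fintype.card V - 2)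
    (he : Even (Fintype.card V)) (hV : 4 ≤ Fintype.card V) {i j t : V} (hij : i ≠ j) (hit : i ≠ t)
    (hjt : j ≠ t) {A B : S} (hAB : A ≠ B) {q : S → Prop} (hq : ∀ s s', q s → q s' → s = s')
    (hqB : ¬ q B) {a : S → V → V → ℝ} {C : ℝ}
    (HA : ∀ τ : V → V → S, IsSched τ → τ i t = A → weight a τ = C)
    (HB : ∀ τ : V → V → S, IsSched τ → τ j t = B → weight a τ = C)
    (HP : ∀ τ : V → V → S, IsSched τ → τ j t = A → ¬ q (τ i t) → weight a τ = C)
    {τ : V → V → S} (hτ : IsSched τ) : weight a τ = C := by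
  obtain ⟨σ₀, hσ₀⟩ := exists_isPM he hV
  have exA : ∀ l m : S, ∃ r, r ≠ l ∧ r ≠ m := exists_ne_ne (by omega)
  have hjt' : ∀ l m, a l j t - a l t j = a m j t - a m t j := by
    have h1 : ∀ {l m}, l ≠ A → m ≠ A → a l j t - a l t j = a m j t - a m t j :=
      orient_of_inter hc he hV hit HA hjt (by simp) (by tauto)
    have h2 : a A j t - a A t j = a B j t - a B t j := by
      obtain ⟨σ, hσ, hσj⟩ := exists_isPM_edge he hV hjt
      obtain ⟨τ, hτ, hτA, hτB⟩ := exists_sched_of_two_matchings hc he hV hσ hσ hAB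
      obtain ⟨τ₁, hτ₁, h1, h2, -⟩ := hτ.exists_oriented (hσj ▸ hτA j)
      have hB₁ : Meets τ₁ B j t := (h2 _ _ _).2 (hσj ▸ hτB j)
      obtain ⟨τ₂, hτ₂, h3, h4, h5⟩ : ∃ τ₂ : V → V → S, IsSched τ₂ ∧ τ₂ j t = A ∧ Meets τ₂ B j t ∧
          ¬ q (τ₂ i t) := by
        by_cases hq1 : q (τ₁ i t)
        · refine ⟨_, hτ₁.swap i t, ?_, meets_swapVenues.2 hB₁, ?_⟩
          · rw [swapVenues_of_ne _ (by tauto), h1]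
          · rw [swapVenues_left]
            exact fun hq2 => hτ₁.ne hit (hq _ _ hq1 hq2)
        · exact ⟨τ₁, hτ₁, h1, hB₁, hq1⟩
      refine orient_of_meets hjt hAB (Or.inl h3) h4 ?_
      have h6 : τ₂ t j = B := h4.resolve_left fun h => hAB (h3.symm.trans h)
      rw [HB _ (hτ₂.swap j t) (by rw [swapVenues_left, h6]), HP _ hτ₂ h3 h5]
    intro l m
    rcases eq_or_ne l A with rfl | hl <;> rcases eq_or_ne m l with rfl | hm
    · rfl
    · rw [h2, h1 hAB.symm hm]
    · rfl
    · rcases eq_or_ne m A with rfl | hm'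
      · rw [h2, h1 hl hAB.symm]
      · exact h1 hl hm'
  have hit' : ∀ l m, a l i t - a l t i = a m i t - a m t i := by
    have h1 : ∀ {l m}, l ≠ B → m ≠ B → a l i t - a l t i = a m i t - a m t i :=
      orient_of_inter hc he hV hjt HB hit (by simp) (by tauto)
    obtain ⟨m, hmA, hmB, hqm⟩ : ∃ m, m ≠ A ∧ m ≠ B ∧ ¬ q m := by
      obtain ⟨m, hm⟩ : ∃ m, m ∉ ({A, B} : Finset S) ∪ univ.filter q := by
        by_contra! h
        have h1 := Finset.card_union_le ({A, B} : Finset S) (univ.filter q)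
        have h2 := Finset.card_le_two (a := A) (b := B)
        have h3 : #(univ.filter q) ≤ 1 := Finset.card_le_one.2 fun x hx y hy =>
          hq x y (Finset.mem_filter.1 hx).2 (Finset.mem_filter.1 hy).2
        rw [Finset.eq_univ_of_forall h, card_univ] at h1
        omega
      simp only [mem_union, mem_insert, mem_singleton, mem_filter, mem_univ, true_and] at hm
      exact ⟨m, by tauto, by tauto, by tauto⟩
    have h2 : a B i t - a B t i = a m i t - a m t i := by
      obtain ⟨σ, hσ, hσi⟩ := exists_isPM_edge he hV hit
      have hσt : σ t = i := by rw [← hσi, hσ.1]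
      obtain ⟨τ, hτ, hτB, hτm, hτA⟩ := exists_sched_of_matchings hc he hV hσ hσ hmB.symm hAB hmA.symm
        hjt.symm (fun h => hij (hσt.symm.trans h.1))
      obtain ⟨τ₁, hτ₁, h3, h4, -⟩ := hτ.exists_oriented hτA.symm
      have hB : Meets τ₁ B i t := (h4 _ _ _).2 (hσi ▸ hτB i)
      have hm : Meets τ₁ m i t := (h4 _ _ _).2 (hσi ▸ hτm i)
      have hq' : ∀ s, s = B ∨ s = m → ¬ q s := by rintro s (rfl | rfl) <;> assumption
      have key : (τ₁ i t = B ∨ τ₁ i t = m) ∧ (τ₁ t i = B ∨ τ₁ t i = m) := by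
        unfold Meets at hB hm
        grind
      refine orient_of_meets hit hmB.symm hB hm ?_
      rw [HP _ (hτ₁.swap i t) (by rw [swapVenues_of_ne _ (by tauto), h3])
        (by rw [swapVenues_left]; exact hq' _ key.2), HP _ hτ₁ h3 (hq' _ key.1)]
    intro l m'
    have h3 : ∀ l, a l i t - a l t i = a m i t - a m t i := fun l => by
      rcases eq_or_ne l B with rfl | hl
      · exact h2
      · exact h1 hl hmB
    rw [h3, h3 m']
  have hd : ∀ l m u v, u ≠ v → a l u v - a l v u = a m u v - a m v u := by
    intro l m u v huv
    by_cases hA : u ≠ i ∧ u ≠ t ∧ v ≠ i ∧ v ≠ t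
    · have := orient_of_disjoint hc he hV hit HA huv hA.1 hA.2.1 hA.2.2.1 hA.2.2.2
      rw [this l, this m]
    by_cases hB : u ≠ j ∧ u ≠ t ∧ v ≠ j ∧ v ≠ t
    · have := orient_of_disjoint hc he hV hjt HB huv hB.1 hB.2.1 hB.2.2.1 hB.2.2.2
      rw [this l, this m]
    by_cases h1 : (i = u ∧ t = v) ∨ (i = v ∧ t = u)
    · have := hit' l m
      rcases h1 with ⟨rfl, rfl⟩ | ⟨rfl, rfl⟩ <;> linarith
    by_cases h2 : (j = u ∧ t = v) ∨ (j = v ∧ t = u)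
    · have := hjt' l m
      rcases h2 with ⟨rfl, rfl⟩ | ⟨rfl, rfl⟩ <;> linarith
    have h3 : ∀ {l m}, l ≠ A → m ≠ A → a l u v - a l v u = a m u v - a m v u :=
      orient_of_inter hc he hV hit HA huv (by grind) h1
    have h4 : ∀ {l m}, l ≠ B → m ≠ B → a l u v - a l v u = a m u v - a m v u :=
      orient_of_inter hc he hV hjt HB huv (by grind) h2
    obtain ⟨r, hrA, hrB⟩ := exA A B
    have h5 : ∀ l, a l u v - a l v u = a r u v - a r v u := fun l => by
      rcases eq_or_ne l A with rfl | hl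
      · exact h4 hAB hrB
      · exact h3 hl hrA
    rw [h5, h5 m]
  simp only [weight_symmetrize hd] at HA HB ⊢
  generalize hbd : (fun s u v => (a s u v + a s v u) / 2) = b at HA HB ⊢
  have hb : ∀ s u v, b s u v = b s v u := fun s u v => by simp [← hbd, add_comm]
  obtain ⟨r, hrA, hrB⟩ := exA A B
  have hG : ∀ l : S, ∀ σ σ' : Equiv.Perm V, IsPM σ → IsPM σ' →
      ∑ u, (b l u (σ u) - b r u (σ u)) = ∑ u, (b l u (σ' u) - b r u (σ' u)) := by
    intro l σ σ' hσ hσ'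
    rcases eq_or_ne l A with rfl | hl
    · exact matching_of_fixed hc he hV hjt hb HB hAB hrB hσ hσ'
    · exact matching_of_fixed hc he hV hit hb HA hl hrA hσ hσ'
  obtain ⟨τ₀, hτ₀, h₀, -⟩ := exists_sched_of_two_matchings hc he hV hσ₀ hσ₀ hAB
  obtain ⟨τ₁, hτ₁, h₁, -⟩ := (hτ₀.comp (Equiv.swap (τ₀ i t) A)).exists_oriented (u := i) (v := t)
    (s := A) (Or.inl (by simp))
  rw [← HA τ₁ hτ₁ h₁]
  refine weight_eq_weight hc hb (fun l m σ σ' hσ hσ' => ?_) A hτ hτ₁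
  have h1 := hG l σ σ' hσ hσ'
  have h2 := hG m σ σ' hσ hσ'
  simp only [Finset.sum_sub_distrib] at h1 h2 ⊢
  linarith

/-! ### Schedules with prescribed matches -/

theorem exists_sched_fixed [Fintype S] (hc : Fintype.card S = 2 * Fintype.card V - 2)
    (he : Even (Fintype.card V)) (hV : 4 ≤ Fintype.card V) (x y : V) (s : S) :
    ∃ τ : V → V → S, IsSched τ ∧ τ x y = s := by
  obtain ⟨σ, hσ⟩ := exists_isPM he hV
  obtain ⟨m, hm, -⟩ := exists_ne_ne (by omega) s s
  obtain ⟨τ, hτ, -⟩ := exists_sched_of_two_matchings hc he hV hσ hσ hm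
  exact ⟨_, hτ.comp (Equiv.swap (τ x y) s), by simp⟩

theorem exists_sched_three [Fintype S] (hc : Fintype.card S = 2 * Fintype.card V - 2)
    (he : Even (Fintype.card V)) (hV : 4 ≤ Fintype.card V) {x y v w : V} (hxy : x ≠ y) (hvw : v ≠ w)
    (hne : ¬ (v = x ∧ w = y)) {s c c' : S} (hc1 : c ≠ s) (hc2 : c' ≠ s) (hcc : c ≠ c') :
    ∃ τ : V → V → S, IsSched τ ∧ τ x y = s ∧ τ v w = c ∧ ∃ z, z ≠ w ∧ τ z w = c' := by
  obtain ⟨τ₀, hτ₀, -⟩ := exists_sched_fixed hc he hV x y s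
  obtain ⟨τ, hτ, h1⟩ : ∃ τ : V → V → S, IsSched τ ∧ τ v w ≠ τ x y := by
    by_cases h : τ₀ v w = τ₀ x y
    · by_cases h' : v = y ∧ w = x
      · rw [h'.1, h'.2] at h
        exact absurd h.symm (hτ₀.ne hxy)
      · refine ⟨_, hτ₀.swap v w, ?_⟩
        rw [swapVenues_left, swapVenues_of_ne _ (by tauto), ← h]
        exact (hτ₀.ne hvw).symm
    · exact ⟨τ₀, hτ₀, h⟩
  obtain ⟨z, hzv, hzw, hz⟩ : ∃ z, z ≠ v ∧ z ≠ w ∧ τ z w ≠ τ x y := by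
    obtain ⟨z₁, h2, h3⟩ := exists_ne_ne (by omega) v w
    by_cases h4 : τ z₁ w = τ x y
    · obtain ⟨z₂, h5⟩ : ∃ z, z ∉ ({v, w, z₁} : Finset V) := by
        by_contra! h
        have := Finset.card_le_three (a := v) (b := w) (c := z₁)
        rw [Finset.eq_univ_of_forall h, card_univ] at this
        omega
      simp only [mem_insert, mem_singleton, not_or] at h5
      exact ⟨z₂, h5.1, h5.2.1, fun h6 =>
        h5.2.2 (hτ z₂ w z₁ w h5.2.1 h3 (by simp) (h6.trans h4.symm)).1⟩
    · exact ⟨z₁, h2, h3, h4⟩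
  have h5 : τ v w ≠ τ z w := fun h => hzv (hτ v w z w hvw hzw (by simp) h).1.symm
  obtain ⟨π, h6, h7, h8⟩ := exists_perm_three h1.symm hz.symm h5 hc1.symm hc2.symm hcc
  exact ⟨_, hτ.comp π, h6, h7, z, hzw, h8⟩

end Schedules

/-! ### Facets via functionals -/

theorem finrank_vectorSpan_of_functional {E : Type*} [AddCommGroup E] [Module ℝ E]
    [FiniteDimensional ℝ E] {P F : Set E} (hFP : F ⊆ P) (φ : E →ₗ[ℝ] ℝ) {c : ℝ}
    (hF : ∀ z ∈ F, φ z = c) {z₁ : E} (hz₁ : z₁ ∈ F) {z₀ : E} (hz₀ : z₀ ∈ P) (hne : φ z₀ ≠ c)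
    (h : ∀ (l : E →ₗ[ℝ] ℝ) (d : ℝ), (∀ z ∈ F, l z = d) → ∃ a b, ∀ z ∈ P, l z = a * φ z + b) :
    Module.finrank ℝ (vectorSpan ℝ F) + 1 = Module.finrank ℝ (vectorSpan ℝ P) := by
  have hvanish : ∀ (l : E →ₗ[ℝ] ℝ) (Q : Set E), (∃ d, ∀ z ∈ Q, l z = d) →
      vectorSpan ℝ Q ≤ LinearMap.ker l := by
    rintro l Q ⟨d, hd⟩
    refine Submodule.span_le.2 ?_
    rintro _ ⟨x, hx, y, hy, rfl⟩
    simp [hd x hx, hd y hy]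
  set ψ : vectorSpan ℝ P →ₗ[ℝ] ℝ := φ ∘ₗ (vectorSpan ℝ P).subtype with hψ
  have hker : (LinearMap.ker ψ).map (vectorSpan ℝ P).subtype = vectorSpan ℝ F := by
    refine le_antisymm ?_ fun x hx => ?_
    · rintro _ ⟨⟨x, hx⟩, hx0, rfl⟩
      by_contra hxF
      obtain ⟨l, hl, hlF⟩ := Submodule.exists_le_ker_of_notMem hxF
      obtain ⟨a, b, hab⟩ := h l (l z₁) fun z hz => by
        have := hlF (vsub_mem_vectorSpan ℝ hz hz₁)
        simpa [sub_eq_zero] using this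
      have := hvanish (l - a • φ) P ⟨b, fun z hz => by simp [hab z hz]⟩ hx
      have hx0' : φ x = 0 := hx0
      simp [hx0'] at this
      exact hl this
    · exact ⟨⟨x, vectorSpan_mono ℝ hFP hx⟩, hvanish φ F ⟨c, hF⟩ hx, rfl⟩
  have hrange : LinearMap.range ψ = ⊤ := by
    refine LinearMap.range_eq_top.2 (LinearMap.surjective fun h0 => ?_)
    have := LinearMap.congr_fun h0 ⟨z₀ - z₁, vsub_mem_vectorSpan ℝ hz₀ (hFP hz₁)⟩
    simp only [hψ, LinearMap.comp_apply, Submodule.subtype_apply, map_sub, hF z₁ hz₁,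
      LinearMap.zero_apply, sub_eq_zero] at this
    exact hne this
  have hrn := LinearMap.finrank_range_add_finrank_ker ψ
  rw [hrange, finrank_top, Module.finrank_self] at hrn
  rw [← hker, Submodule.finrank_map_subtype_eq, ← hrn, add_comm]

/-! ### Tournaments as schedules -/

/-- The teams `1, …, n`. -/
abbrev Team (n : ℕ) : Type := Finset.Icc 1 n

/-- The slots `1, …, 2n-2`. -/
abbrev Slot (n : ℕ) : Type := Finset.Icc 1 (2 * n - 2)

/-- The set of matches of a schedule. -/
def matchSet {n : ℕ} (τ : Team n → Team n → Slot n) : Set (ℕ × ℕ × ℕ) :=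
  {m | ∃ u v : Team n, u ≠ v ∧ m = ((τ u v : ℕ), (u : ℕ), (v : ℕ))}

section Polytope

variable {n : ℕ}

theorem card_slot : Fintype.card (Slot n) = 2 * Fintype.card (Team n) - 2 := by
  simp

theorem mem_matchSet {τ : Team n → Team n → Slot n} {u v : Team n} (huv : u ≠ v) {k : ℕ} :
    (k, (u : ℕ), (v : ℕ)) ∈ matchSet τ ↔ (τ u v : ℕ) = k := by
  constructor
  · rintro ⟨u', v', -, h⟩
    simp only [Prod.mk.injEq] at h
    rw [Subtype.ext h.2.1, Subtype.ext h.2.2, h.1]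
  · rintro rfl
    exact ⟨u, v, huv, rfl⟩

theorem isMatch_coe {s : Slot n} {u v : Team n} (huv : u ≠ v) :
    IsMatch n ((s : ℕ), (u : ℕ), (v : ℕ)) := by
  have hs := Finset.mem_Icc.1 s.2
  have hu := Finset.mem_Icc.1 u.2
  have hv := Finset.mem_Icc.1 v.2
  exact ⟨hs.1, hs.2, hu.1, hu.2, hv.1, hv.2, fun h => huv (Subtype.ext h)⟩

theorem isTravelIdx_coe {t u v : Team n} (huv : u ≠ v) :
    IsTravelIdx n ((t : ℕ), (u : ℕ), (v : ℕ)) := by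
  have ht := Finset.mem_Icc.1 t.2
  have hu := Finset.mem_Icc.1 u.2
  have hv := Finset.mem_Icc.1 v.2
  exact ⟨ht.1, ht.2, hu.1, hu.2, hv.1, hv.2, fun h => huv (Subtype.ext h)⟩

theorem IsSched.isTournament {τ : Team n → Team n → Slot n} (h : IsSched τ) :
    IsTournament n (matchSet τ) where
  subset := by
    rintro m ⟨u, v, huv, rfl⟩
    exact isMatch_coe huv
  slot_team := by
    intro k hk1 hk2 t ht1 htn
    obtain ⟨v, hv, hm⟩ := h.exists_opp card_slot ⟨k, Finset.mem_Icc.2 ⟨hk1, hk2⟩⟩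
      ⟨t, Finset.mem_Icc.2 ⟨ht1, htn⟩⟩
    set t' : Team n := ⟨t, Finset.mem_Icc.2 ⟨ht1, htn⟩⟩ with ht'
    have huniq : ∀ u v : Team n, u ≠ v → (t' = u ∨ t' = v) → (τ u v : ℕ) = k →
        ∀ m : ℕ × ℕ × ℕ, m ∈ matchSet τ ∧ m.1 = k ∧ (t = m.2.1 ∨ t = m.2.2) →
          m = (k, (u : ℕ), (v : ℕ)) := by
      rintro u v huv htuv hk _ ⟨⟨a, b, hab, rfl⟩, hk', hts⟩
      have hts' : t' = a ∨ t' = b := hts.imp (fun h => Subtype.ext h) fun h => Subtype.ext h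
      obtain ⟨rfl, rfl⟩ := h a b u v hab huv (by grind) (Subtype.ext (hk'.trans hk.symm))
      simp only at hk'
      rw [hk']
    rcases hm with hm | hm
    · have hk : (τ t' v : ℕ) = k := by rw [hm]
      exact ⟨(k, t, v), ⟨(mem_matchSet hv.symm).2 hk, rfl, Or.inl rfl⟩,
        huniq t' v hv.symm (Or.inl rfl) hk⟩
    · have hk : (τ v t' : ℕ) = k := by rw [hm]
      exact ⟨(k, v, t), ⟨(mem_matchSet hv).2 hk, rfl, Or.inr rfl⟩,
        huniq v t' hv (Or.inr rfl) hk⟩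
  pair := by
    intro i j hi1 hin hj1 hjn hij
    have hne : (⟨i, Finset.mem_Icc.2 ⟨hi1, hin⟩⟩ : Team n) ≠ ⟨j, Finset.mem_Icc.2 ⟨hj1, hjn⟩⟩ :=
      fun h => hij (congrArg Subtype.val h)
    exact ⟨_, (mem_matchSet hne).2 rfl, fun k hk => ((mem_matchSet hne).1 hk).symm⟩

theorem IsTournament.exists_sched (hn : 4 ≤ n) {T : Set (ℕ × ℕ × ℕ)} (h : IsTournament n T) :
    ∃ τ : Team n → Team n → Slot n, IsSched τ ∧ T = matchSet τ := by
  have hex : ∀ u v : Team n, ∃ s : Slot n, u ≠ v → ((s : ℕ), (u : ℕ), (v : ℕ)) ∈ T := by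
    intro u v
    have hu := Finset.mem_Icc.1 u.2
    have hv := Finset.mem_Icc.1 v.2
    by_cases huv : u = v
    · exact ⟨⟨1, Finset.mem_Icc.2 ⟨le_rfl, by omega⟩⟩, fun h => absurd huv h⟩
    · obtain ⟨k, hk, -⟩ := h.pair u v hu.1 hu.2 hv.1 hv.2 fun h => huv (Subtype.ext h)
      exact ⟨⟨k, Finset.mem_Icc.2 ⟨(h.subset _ hk).1, (h.subset _ hk).2.1⟩⟩, fun _ => hk⟩
  choose τ hτ using hex
  have hT : T = matchSet τ := by
    ext ⟨k, i, j⟩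
    constructor
    · intro hk
      obtain ⟨h1, h2, hi1, hin, hj1, hjn, hij⟩ := h.subset _ hk
      simp only at h1 h2 hi1 hin hj1 hjn hij
      have hne : (⟨i, Finset.mem_Icc.2 ⟨hi1, hin⟩⟩ : Team n) ≠ ⟨j, Finset.mem_Icc.2 ⟨hj1, hjn⟩⟩ :=
        fun h => hij (congrArg Subtype.val h)
      exact (mem_matchSet hne).2 ((h.pair i j hi1 hin hj1 hjn hij).unique (hτ _ _ hne) hk)
    · rintro ⟨u, v, huv, he⟩
      rw [he]
      exact hτ u v huv
  refine ⟨τ, fun u v u' v' huv huv' hs he => ?_, hT⟩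
  have hk := Finset.mem_Icc.1 (τ u v).2
  have key : ∀ w : Team n, (w = u ∨ w = v) → (w = u' ∨ w = v') → u = u' ∧ v = v' := by
    intro w h1 h2
    have hw := Finset.mem_Icc.1 w.2
    have := (h.slot_team _ hk.1 hk.2 w hw.1 hw.2).unique
      (y₁ := ((τ u v : ℕ), (u : ℕ), (v : ℕ))) (y₂ := ((τ u' v' : ℕ), (u' : ℕ), (v' : ℕ)))
      ⟨hτ u v huv, rfl, h1.imp (congrArg Subtype.val) (congrArg Subtype.val)⟩
      ⟨hτ u' v' huv', by rw [he], h2.imp (congrArg Subtype.val) (congrArg Subtype.val)⟩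
    simp only [Prod.mk.injEq] at this
    exact ⟨Subtype.ext this.2.1, Subtype.ext this.2.2⟩
  rcases hs with h1 | h1 | h1 | h1
  · exact key u (by simp) (by simp [h1])
  · exact key u (by simp) (by simp [h1])
  · exact key v (by simp) (by simp [h1])
  · exact key v (by simp) (by simp [h1])

theorem venue_eq_iff {τ : Team n → Team n → Slot n} (h : IsSched τ) {u t : Team n} (hut : u ≠ t)
    {k : ℕ} : venue (matchSet τ) t k = u ↔ (τ u t : ℕ) = k := by
  rw [venue]
  split_ifs with hex
  · obtain ⟨b, ⟨u', v', huv', he⟩, htb⟩ := hex.choose_spec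
    simp only [Prod.mk.injEq] at he
    rw [he.2.1, he.2.2] at htb
    rw [he.2.1]
    have ht : t = u' ∨ t = v' := htb.imp (fun h => Subtype.ext h) fun h => Subtype.ext h
    constructor
    · intro hu
      obtain rfl : u' = u := Subtype.ext hu
      obtain rfl : t = v' := ht.resolve_left hut.symm
      exact he.1.symm
    · intro hk
      rw [(h u t u' v' hut huv' (by tauto) (Subtype.ext (hk.trans he.1))).1]
  · refine ⟨fun h => absurd (Subtype.ext h.symm) hut, fun hk => absurd ⟨u, t, ?_, Or.inr rfl⟩ hex⟩
    exact (mem_matchSet hut).2 hk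

theorem travel_away_away {τ : Team n → Team n → Slot n} (h : IsSched τ) {t u v : Team n}
    (hut : u ≠ t) (hvt : v ≠ t) :
    travel n (matchSet τ) (t, u, v) = if (τ v t : ℕ) = τ u t + 1 then 1 else 0 := by
  have := Finset.mem_Icc.1 (τ u t).2
  simp only [travel, venue_eq_iff h hut, venue_eq_iff h hvt]
  congr 1
  refine propext ⟨fun ⟨k, _, h1, h2⟩ => by rw [h1, h2], fun h => ⟨_, this.2, rfl, h⟩⟩

theorem travel_eq_zero_or_one (T : Set (ℕ × ℕ × ℕ)) (p : ℕ × ℕ × ℕ) :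
    travel n T p = 0 ∨ travel n T p = 1 := by
  rw [travel]
  split_ifs <;> simp

theorem exists_consecutive (hn : 4 ≤ n) (s : Slot n) :
    ∃ c c' : Slot n, (c' : ℕ) = c + 1 ∧ c ≠ s ∧ c' ≠ s := by
  by_cases hs : 3 ≤ (s : ℕ)
  · refine ⟨⟨1, by simp; omega⟩, ⟨2, by simp; omega⟩, rfl, ?_, ?_⟩ <;>
    · intro h
      have := congrArg Subtype.val h
      simp only at this
      omega
  · refine ⟨⟨3, by simp; omega⟩, ⟨4, by simp; omega⟩, rfl, ?_, ?_⟩ <;>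
    · intro h
      have := congrArg Subtype.val h
      simp only at this
      omega

theorem exists_sched_travel_eq_zero (hn : 4 ≤ n) (he : Even n) {i j t : Team n} (hij : i ≠ j)
    (hit : i ≠ t) (hjt : j ≠ t) (A B : Slot n) {w u v : Team n} (huv : u ≠ v) :
    ∃ τ : Team n → Team n → Slot n, IsSched τ ∧ (τ i t = A ∨ τ j t = B) ∧
      travel n (matchSet τ) (w, u, v) = 0 := by
  have hev : Even (Fintype.card (Team n)) := by simpa using he
  have hV : 4 ≤ Fintype.card (Team n) := by simpa using hn
  have hface : ∀ x : Team n, x ≠ w → ∃ s : Slot n, ∀ c c', c ≠ s → c' ≠ s → c ≠ c' →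
      ∃ τ : Team n → Team n → Slot n, IsSched τ ∧ (τ i t = A ∨ τ j t = B) ∧
        τ x w = c ∧ ∃ z, z ≠ w ∧ τ z w = c' := by
    intro x hx
    by_cases h : x = i ∧ w = t
    · refine ⟨B, fun c c' h1 h2 h3 => ?_⟩
      obtain ⟨τ, hτ, h5, h6⟩ := exists_sched_three card_slot hev hV hjt hx
        (fun h' => hij (h.1.symm.trans h'.1)) h1 h2 h3
      exact ⟨τ, hτ, Or.inr h5, h6⟩
    · refine ⟨A, fun c c' h1 h2 h3 => ?_⟩
      obtain ⟨τ, hτ, h5, h6⟩ := exists_sched_three card_slot hev hV hit hx h h1 h2 h3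
      exact ⟨τ, hτ, Or.inl h5, h6⟩
  by_cases huw : u = w
  · subst huw
    obtain ⟨s, hs⟩ := hface v huv.symm
    obtain ⟨c, c', hcc, h1, h2⟩ := exists_consecutive hn s
    obtain ⟨τ, hτ, hf, hv, z, hz, hzc⟩ := hs c' c h2 h1 fun h => by rw [h] at hcc; omega
    refine ⟨τ, hτ, hf, if_neg ?_⟩
    rintro ⟨k, -, hk, hk'⟩
    have hk' := (venue_eq_iff hτ huv.symm).1 hk'
    have hkc : (τ z u : ℕ) = k := by rw [hzc]; rw [hv] at hk'; omega
    exact hz (Subtype.ext (((venue_eq_iff hτ hz).2 hkc).symm.trans hk))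
  by_cases hvw : v = w
  · subst hvw
    obtain ⟨s, hs⟩ := hface u huv
    obtain ⟨c, c', hcc, h1, h2⟩ := exists_consecutive hn s
    obtain ⟨τ, hτ, hf, hu, z, hz, hzc⟩ := hs c c' h1 h2 fun h => by rw [h] at hcc; omega
    refine ⟨τ, hτ, hf, if_neg ?_⟩
    rintro ⟨k, -, hk, hk'⟩
    have hk := (venue_eq_iff hτ huv).1 hk
    have hkc : (τ z v : ℕ) = k + 1 := by rw [hzc]; rw [hu] at hk; omega
    exact hz (Subtype.ext (((venue_eq_iff hτ hz).2 hkc).symm.trans hk'))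
  obtain ⟨τ, hτ, hA⟩ := exists_sched_fixed (S := Slot n) card_slot hev hV i t A
  by_cases hc : (τ v w : ℕ) = τ u w + 1
  · by_cases hs : (v = i ∧ w = t) ∨ (v = t ∧ w = i)
    · refine ⟨swapVenues u w τ, hτ.swap u w, Or.inl ?_, ?_⟩
      · rw [swapVenues_of_ne _ (by grind), hA]
      · rw [travel_away_away (hτ.swap u w) huw hvw, if_neg]
        rw [swapVenues_left, swapVenues_of_ne _ (by grind), hc]
        exact fun h => hτ.ne huw (Subtype.ext (by omega))
    · refine ⟨swapVenues v w τ, hτ.swap v w, Or.inl ?_, ?_⟩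
      · rw [swapVenues_of_ne _ (by grind), hA]
      · rw [travel_away_away (hτ.swap v w) huw hvw, if_neg]
        rw [swapVenues_left, swapVenues_of_ne _ (by grind), ← hc]
        exact fun h => hτ.ne hvw (Subtype.ext h.symm)
  · exact ⟨τ, hτ, Or.inl hA, by rw [travel_away_away hτ huw hvw, if_neg hc]⟩

/-! ### The polytope in terms of schedules -/

instance : Finite {m : ℕ × ℕ × ℕ // IsMatch n m} :=
  (Set.finite_Icc (1, 1, 1) (2 * n - 2, n, n)).subset
    fun _ ⟨h1, h2, h3, h4, h5, h6, _⟩ => ⟨⟨h1, h3, h5⟩, h2, h4, h6⟩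

instance : Finite {p : ℕ × ℕ × ℕ // IsTravelIdx n p} :=
  (Set.finite_Icc (1, 1, 1) (n, n, n)).subset
    fun _ ⟨h1, h2, h3, h4, h5, h6, _⟩ => ⟨⟨h1, h3, h5⟩, h2, h4, h6⟩

/-- The play vector of a schedule. -/
noncomputable def playVec (τ : Team n → Team n → Slot n) :
    {m : ℕ × ℕ × ℕ // IsMatch n m} → ℝ := fun m => play (matchSet τ) m.1

/-- The points generating `Ptt n`, in terms of schedules. -/
def vertices (n : ℕ) : Set (Pt n) :=
  {z | ∃ τ : Team n → Team n → Slot n, IsSched τ ∧ z.1 = playVec τ ∧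
    (∀ p, z.2 p = 0 ∨ z.2 p = 1) ∧ ∀ p, travel n (matchSet τ) p.1 ≤ z.2 p}

theorem ptt_eq (hn : 4 ≤ n) : Ptt n = convexHull ℝ (vertices n) := by
  rw [Ptt]
  congr 1
  ext z
  constructor
  · rintro ⟨T, hT, h1, h2, h3⟩
    obtain ⟨τ, hτ, rfl⟩ := hT.exists_sched hn
    exact ⟨τ, hτ, funext h1, h2, h3⟩
  · rintro ⟨τ, hτ, h1, h2, h3⟩
    exact ⟨_, hτ.isTournament, fun m => by rw [h1, playVec], h2, h3⟩

/-- The coordinate `x_{k,u,v}` as a linear form. -/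
noncomputable def xLin (n k u v : ℕ) : ({m : ℕ × ℕ × ℕ // IsMatch n m} → ℝ) →ₗ[ℝ] ℝ :=
  if h : IsMatch n (k, u, v) then LinearMap.proj ⟨(k, u, v), h⟩ else 0

theorem xval_eq (z : Pt n) (k u v : ℕ) : xval z k u v = xLin n k u v z.1 := by
  rw [xval, xLin]
  split_ifs <;> rfl

theorem xLin_playVec (τ : Team n → Team n → Slot n) (s : Slot n) {u v : Team n} (huv : u ≠ v) :
    xLin n s u v (playVec τ) = if τ u v = s then 1 else 0 := by
  rw [xLin, dif_pos (isMatch_coe huv)]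
  simp only [LinearMap.proj_apply, playVec, play, mem_matchSet huv, Subtype.ext_iff]

theorem exists_weight (f : ({m : ℕ × ℕ × ℕ // IsMatch n m} → ℝ) →ₗ[ℝ] ℝ) :
    ∃ a : Slot n → Team n → Team n → ℝ, ∀ τ, f (playVec τ) = weight a τ := by
  refine ⟨fun s u v => f fun m => if m.1 = ((s : ℕ), (u : ℕ), (v : ℕ)) then 1 else 0,
    fun τ => ?_⟩
  rw [weight, ← map_sum]
  congr 1
  ext ⟨⟨k, u, v⟩, hm⟩
  obtain ⟨-, -, hu1, hun, hv1, hvn, huv⟩ := id hm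
  lift u to Team n using Finset.mem_Icc.2 ⟨hu1, hun⟩
  lift v to Team n using Finset.mem_Icc.2 ⟨hv1, hvn⟩
  have hne : u ≠ v := fun h => huv (congrArg Subtype.val h)
  rw [Finset.sum_apply, Finset.sum_eq_single (u, v)]
  · simp only [playVec, play, mem_matchSet hne, Prod.mk.injEq, and_true, eq_comm]
  · rintro ⟨u', v'⟩ - h
    refine if_neg fun h' => h ?_
    simp only [Prod.mk.injEq] at h'
    rw [Subtype.ext h'.2.1, Subtype.ext h'.2.2]
  · simp [hne]

/-- A linear form on `Pt n` depends on the travel coordinates only through those it is nonzero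
on. -/
theorem apply_eq_of_single {l : Pt n →ₗ[ℝ] ℝ} {p₀ : {p : ℕ × ℕ × ℕ // IsTravelIdx n p}}
    (h : ∀ p, p ≠ p₀ → l (0, Pi.single p 1) = 0) (z : Pt n) :
    l z = l (z.1, 0) + l (0, Pi.single p₀ 1) * z.2 p₀ := by
  have := Fintype.ofFinite {p : ℕ × ℕ × ℕ // IsTravelIdx n p}
  have hz : z = (z.1, 0) + ∑ p, z.2 p • ((0, Pi.single p 1) : Pt n) := by
    refine Prod.ext ?_ ?_
    · simp [Prod.fst_sum]
    · ext q
      simp [Prod.snd_sum, Finset.sum_apply, Pi.single_apply]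
  conv_lhs => rw [hz]
  rw [map_add, map_sum, Finset.sum_eq_single p₀]
  · rw [map_smul, smul_eq_mul, mul_comm]
  · intro p _ hp
    rw [map_smul, h p hp, smul_zero]
  · simp

/-! ### The lifted inequalities -/

section Lifted

variable {i j t r : Team n} {A B s : Slot n}

theorem sum_ite_le_and_eq (hij : i ≠ j) (hit : i ≠ t) (hjt : j ≠ t) (hAB : (B : ℕ) = A + 1)
    (hrs : (r = j ∧ s = A) ∨ (r = i ∧ s = B)) {τ : Team n → Team n → Slot n} (hτ : IsSched τ) :
    ((if τ r t = s then (1 : ℝ) else 0) + (if τ i t = A then 1 else 0) + (if τ j t = B then 1 else 0)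
        ≤ 1 + if (τ j t : ℕ) = τ i t + 1 then 1 else 0) ∧
    (τ i t = A ∨ τ j t = B ∨ (τ r t = s ∧ (τ j t : ℕ) ≠ τ i t + 1) →
      (if τ r t = s then (1 : ℝ) else 0) + (if τ i t = A then 1 else 0) +
        (if τ j t = B then 1 else 0) = 1 + if (τ j t : ℕ) = τ i t + 1 then 1 else 0) := by
  have hne : τ i t ≠ τ j t := fun h => hij (hτ i t j t hit hjt (by simp) h).1
  have hA : τ i t = A ↔ (τ i t : ℕ) = A := Subtype.ext_iff
  have hB : τ j t = B ↔ (τ j t : ℕ) = A + 1 := by rw [Subtype.ext_iff, hAB]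
  have hne' : (τ i t : ℕ) ≠ τ j t := fun h => hne (Subtype.ext h)
  rcases hrs with ⟨rfl, rfl⟩ | ⟨rfl, rfl⟩
  · have hr : τ r t = s ↔ (τ r t : ℕ) = s := Subtype.ext_iff
    simp only [hA, hB, hr]
    constructor
    · split_ifs <;> first | omega | norm_num
    · intro h
      split_ifs <;> first | omega | norm_num
  · have hr : τ r t = s ↔ (τ r t : ℕ) = A + 1 := by rw [Subtype.ext_iff, hAB]
    simp only [hA, hB, hr]
    constructor
    · split_ifs <;> first | omega | norm_num
    · intro h
      split_ifs <;> first | omega | norm_num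

theorem playVec_const (hn : 4 ≤ n) (he : Even n) (hij : i ≠ j) (hit : i ≠ t) (hjt : j ≠ t)
    (hAB : (B : ℕ) = A + 1) (hrs : (r = j ∧ s = A) ∨ (r = i ∧ s = B))
    {f : ({m : ℕ × ℕ × ℕ // IsMatch n m} → ℝ) →ₗ[ℝ] ℝ} {C : ℝ}
    (hf : ∀ τ : Team n → Team n → Slot n, IsSched τ →
      (τ i t = A ∨ τ j t = B ∨ (τ r t = s ∧ (τ j t : ℕ) ≠ τ i t + 1)) → f (playVec τ) = C)
    {τ : Team n → Team n → Slot n} (hτ : IsSched τ) : f (playVec τ) = C := by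
  obtain ⟨a, ha⟩ := exists_weight f
  simp only [ha] at hf ⊢
  have hev : Even (Fintype.card (Team n)) := by simpa using he
  have hV : 4 ≤ Fintype.card (Team n) := by simpa using hn
  have hne : A ≠ B := fun h => by rw [h] at hAB; omega
  rcases hrs with ⟨rfl, rfl⟩ | ⟨rfl, rfl⟩
  · exact weight_const_of_face (q := fun s' => (s' : ℕ) + 1 = s) card_slot hev hV hij hit hjt hne
      (fun s₁ s₂ h₁ h₂ => Subtype.ext (by omega)) (by omega)
      (fun τ hτ h => hf τ hτ (Or.inl h)) (fun τ hτ h => hf τ hτ (Or.inr (Or.inl h)))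
      (fun τ hτ h h' => hf τ hτ (Or.inr (Or.inr ⟨h, by rw [h]; exact fun e => h' e.symm⟩))) hτ
  · exact weight_const_of_face (q := fun s' => (s' : ℕ) = s + 1) card_slot hev hV hij.symm hjt hit
      hne.symm (fun s₁ s₂ h₁ h₂ => Subtype.ext (by omega)) (by omega)
      (fun τ hτ h => hf τ hτ (Or.inr (Or.inl h))) (fun τ hτ h => hf τ hτ (Or.inl h))
      (fun τ hτ h h' => hf τ hτ (Or.inr (Or.inr ⟨h, by rw [h]; exact h'⟩))) hτ

theorem isFacetLE_lifted (hn : 4 ≤ n) (he : Even n) (hij : i ≠ j) (hit : i ≠ t) (hjt : j ≠ t)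
    (hAB : (B : ℕ) = A + 1) (hrs : (r = j ∧ s = A) ∨ (r = i ∧ s = B)) :
    IsFacetLE (fun z : Pt n => xval z s r t + xval z A i t + xval z B j t - yval z t i j) 1 := by
  have hrt : r ≠ t := by rcases hrs with ⟨rfl, -⟩ | ⟨rfl, -⟩ <;> assumption
  have hev : Even (Fintype.card (Team n)) := by simpa using he
  have hV : 4 ≤ Fintype.card (Team n) := by simpa using hn
  set p₀ : {p : ℕ × ℕ × ℕ // IsTravelIdx n p} := ⟨_, isTravelIdx_coe (t := t) hij⟩ with hp₀
  set ξ := xLin n s r t + xLin n A i t + xLin n B j t with hξ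
  set φ : Pt n →ₗ[ℝ] ℝ := ξ ∘ₗ LinearMap.fst ℝ _ _ -
    LinearMap.proj (R := ℝ) (φ := fun _ => ℝ) p₀ ∘ₗ LinearMap.snd ℝ _ _
  have hφ_apply : ∀ z, φ z = ξ z.1 - z.2 p₀ := fun z => rfl
  have hform : (fun z : Pt n => xval z s r t + xval z A i t + xval z B j t - yval z t i j) = φ := by
    ext z
    rw [xval_eq, xval_eq, xval_eq, yval, dif_pos (isTravelIdx_coe hij)]
    rfl
  have hξ_play : ∀ τ, ξ (playVec τ) = (if τ r t = s then (1 : ℝ) else 0) +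
      (if τ i t = A then 1 else 0) + if τ j t = B then 1 else 0 := fun τ => by
    simp only [hξ, LinearMap.add_apply, xLin_playVec _ _ hrt, xLin_playVec _ _ hit,
      xLin_playVec _ _ hjt]
  have hle : ∀ z ∈ vertices n, φ z ≤ 1 := by
    rintro z ⟨τ, hτ, h1, -, h3⟩
    have := h3 p₀
    rw [hp₀, travel_away_away hτ hit hjt, ← hp₀] at this
    rw [hφ_apply, h1, hξ_play]
    linarith [(sum_ite_le_and_eq hij hit hjt hAB hrs hτ).1]
  have hle_hull : ∀ z ∈ Ptt n, φ z ≤ 1 := by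
    rw [ptt_eq hn]
    exact convexHull_min hle (convex_halfSpace_le φ.isLinear 1)
  have hface : ∀ τ : Team n → Team n → Slot n, IsSched τ →
      (τ i t = A ∨ τ j t = B ∨ (τ r t = s ∧ (τ j t : ℕ) ≠ τ i t + 1)) →
      ∀ y : {p : ℕ × ℕ × ℕ // IsTravelIdx n p} → ℝ, (∀ p, y p = 0 ∨ y p = 1) →
      (∀ p, travel n (matchSet τ) p.1 ≤ y p) → y p₀ = travel n (matchSet τ) p₀.1 →
      (playVec τ, y) ∈ {z ∈ Ptt n | φ z = 1} := by
    intro τ hτ htight y h01 hy hy₀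
    refine ⟨?_, ?_⟩
    · rw [ptt_eq hn]
      exact subset_convexHull ℝ _ ⟨τ, hτ, rfl, h01, hy⟩
    · rw [hp₀, travel_away_away hτ hit hjt, ← hp₀] at hy₀
      rw [hφ_apply, hξ_play, (sum_ite_le_and_eq hij hit hjt hAB hrs hτ).2 htight]
      exact (congrArg _ hy₀).trans (add_sub_cancel_right _ _)
  set top : (Team n → Team n → Slot n) → {p : ℕ × ℕ × ℕ // IsTravelIdx n p} → ℝ := fun τ p =>
    if p = p₀ then travel n (matchSet τ) p.1 else 1 with htop
  have htop₀ : ∀ τ, top τ p₀ = travel n (matchSet τ) p₀.1 := fun τ => if_pos rfl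
  have htop01 : ∀ τ p, top τ p = 0 ∨ top τ p = 1 := fun τ p => by
    rw [htop]
    simp only
    split_ifs
    · exact travel_eq_zero_or_one _ _
    · exact Or.inr rfl
  have htop_le : ∀ τ p, travel n (matchSet τ) p.1 ≤ top τ p := fun τ p => by
    rw [htop]
    simp only
    split_ifs
    · exact le_rfl
    · rcases travel_eq_zero_or_one (n := n) (matchSet τ) p.1 with h | h <;> simp [h]
  rw [hform]
  refine ⟨hle_hull, ?_⟩
  obtain ⟨τ₁, hτ₁, hA⟩ := exists_sched_fixed (S := Slot n) card_slot hev hV i t A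
  obtain ⟨τ₀, hτ₀, hA'⟩ := exists_sched_fixed (S := Slot n) card_slot hev hV t i A
  have hz₀ : (playVec τ₀, 1) ∈ Ptt n := by
    rw [ptt_eq hn]
    refine subset_convexHull ℝ _ ⟨τ₀, hτ₀, rfl, fun p => Or.inr rfl, fun p => ?_⟩
    rcases travel_eq_zero_or_one (n := n) (matchSet τ₀) p.1 with h | h <;> simp [h]
  have hne : φ (playVec τ₀, 1) ≠ 1 := by
    have h1 : τ₀ i t ≠ A := fun h => hτ₀.ne hit (h.trans hA'.symm)
    have h2 : ¬ (τ₀ r t = s ∧ τ₀ j t = B) := by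
      rintro ⟨h3, h4⟩
      rcases hrs with ⟨rfl, rfl⟩ | ⟨rfl, rfl⟩
      · rw [← h3, ← h4] at hAB
        omega
      · exact hij (hτ₀ r t j t hit hjt (by simp) (h3.trans h4.symm)).1
    rw [show φ (playVec τ₀, 1) = ξ (playVec τ₀) - 1 from rfl, hξ_play, if_neg h1]
    split_ifs with h3 h4
    · exact absurd ⟨h3, h4⟩ h2
    all_goals norm_num
  rw [adim, adim, direction_affineSpan, direction_affineSpan]
  refine finrank_vectorSpan_of_functional (fun z hz => hz.1) φ (fun z hz => hz.2)
    (hface τ₁ hτ₁ (Or.inl hA) _ (htop01 τ₁) (htop_le τ₁) (htop₀ τ₁)) hz₀ hne ?_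
  intro l d hl
  have hsingle : ∀ p, p ≠ p₀ → l (0, Pi.single p 1) = 0 := by
    rintro ⟨⟨w, u, v⟩, hp⟩ hpp
    set p : {p : ℕ × ℕ × ℕ // IsTravelIdx n p} := ⟨(w, u, v), hp⟩
    obtain ⟨hw1, hwn, hu1, hun, hv1, hvn, huv⟩ := id hp
    obtain ⟨τ, hτ, htight, htr⟩ := exists_sched_travel_eq_zero hn he hij hit hjt A B
      (w := ⟨w, Finset.mem_Icc.2 ⟨hw1, hwn⟩⟩) (u := ⟨u, Finset.mem_Icc.2 ⟨hu1, hun⟩⟩)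
      (v := ⟨v, Finset.mem_Icc.2 ⟨hv1, hvn⟩⟩) fun h => huv (congrArg Subtype.val h)
    have htight' := htight.imp_right (Or.inl (b := τ r t = s ∧ (τ j t : ℕ) ≠ τ i t + 1))
    have h1 := hl _ (hface τ hτ htight' _ (htop01 τ) (htop_le τ) (htop₀ τ))
    have h2 := hl _ (hface τ hτ htight' (Function.update (top τ) p 0)
      (fun q => by
        by_cases hq : q = p
        · rw [hq, Function.update_self]
          exact Or.inl rfl
        · rw [Function.update_of_ne hq]
          exact htop01 τ q)
      (fun q => by
        by_cases hq : q = p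
        · rw [hq, Function.update_self]
          exact htr.le
        · rw [Function.update_of_ne hq]
          exact htop_le τ q)
      (by rw [Function.update_of_ne hpp.symm, htop₀]))
    have h3 : ((0, Pi.single p 1) : Pt n) =
        (playVec τ, top τ) - (playVec τ, Function.update (top τ) p 0) := by
      refine Prod.ext (sub_self _).symm ?_
      ext q
      by_cases hq : q = p
      · rw [hq]
        simp [htop, hpp]
      · simp [hq]
    rw [h3, map_sub, h1, h2, sub_self]
  have hlz := apply_eq_of_single hsingle
  set c := l (0, Pi.single p₀ 1)
  set f := l ∘ₗ LinearMap.inl ℝ _ _ + c • ξ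
  have hf_apply : ∀ x, f x = l (x, 0) + c * ξ x := fun x => rfl
  have hconst : ∀ τ : Team n → Team n → Slot n, IsSched τ → f (playVec τ) = d + c := by
    intro τ hτ
    refine playVec_const hn he hij hit hjt hAB hrs (fun τ hτ htight => ?_) hτ
    have hmem := hface τ hτ htight _ (htop01 τ) (htop_le τ) (htop₀ τ)
    have h1 := hl _ hmem
    have h2 := hmem.2
    rw [hlz] at h1
    rw [hφ_apply] at h2
    simp only at h1 h2
    rw [hf_apply]
    linear_combination h1 + c * h2
  refine ⟨-c, d + c, fun z hz => ?_⟩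
  have hmem : z ∈ {z | (l + c • φ) z = d + c} := by
    rw [ptt_eq hn] at hz
    refine convexHull_min ?_ (convex_hyperplane (l + c • φ).isLinear _) hz
    rintro z ⟨τ, hτ, h1, -, -⟩
    have := hconst τ hτ
    rw [hf_apply, ← h1] at this
    simp only [Set.mem_ofPred_eq, LinearMap.add_apply, LinearMap.smul_apply, smul_eq_mul]
    rw [hlz, hφ_apply]
    linear_combination this
  simp only [Set.mem_ofPred_eq, LinearMap.add_apply, LinearMap.smul_apply, smul_eq_mul] at hmem
  linear_combination hmem

end Lifted

end Polytope

/-- the two lifted away-away inequalities are facet-defining. -/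
theorem lifted_away_away_facet (n : ℕ) (hn : 4 ≤ n) (heven : Even n)
    (k : ℕ) (hk1 : 1 ≤ k) (hk2 : k ≤ 2 * n - 2) (hk3 : k ≠ 2 * n - 2)
    (i j t : ℕ) (hi1 : 1 ≤ i) (hin : i ≤ n) (hj1 : 1 ≤ j) (hjn : j ≤ n)
    (ht1 : 1 ≤ t) (htn : t ≤ n) (hij : i ≠ j) (hit : i ≠ t) (hjt : j ≠ t) :
    IsFacetLE (fun z : Pt n =>
      xval z k j t + xval z k i t + xval z (k + 1) j t - yval z t i j) 1 ∧
    IsFacetLE (fun z : Pt n =>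
      xval z (k + 1) i t + xval z k i t + xval z (k + 1) j t - yval z t i j) 1 := by
  have h2 : k + 1 ≤ 2 * n - 2 := by omega
  lift i to Team n using Finset.mem_Icc.2 ⟨hi1, hin⟩
  lift j to Team n using Finset.mem_Icc.2 ⟨hj1, hjn⟩
  lift t to Team n using Finset.mem_Icc.2 ⟨ht1, htn⟩
  replace hij : i ≠ j := fun h => hij (congrArg Subtype.val h)
  replace hit : i ≠ t := fun h => hit (congrArg Subtype.val h)
  replace hjt : j ≠ t := fun h => hjt (congrArg Subtype.val h)
  have hA := Finset.mem_Icc.2 ⟨hk1, hk2⟩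
  have hB := Finset.mem_Icc.2 ⟨hk1.trans k.le_succ, h2⟩
  exact ⟨isFacetLE_lifted (A := ⟨k, hA⟩) (B := ⟨k + 1, hB⟩) hn heven hij hit hjt rfl
      (Or.inl ⟨rfl, rfl⟩),
    isFacetLE_lifted (A := ⟨k, hA⟩) (B := ⟨k + 1, hB⟩) hn heven hij hit hjt rfl
      (Or.inr ⟨rfl, rfl⟩)⟩

end TTP
end
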